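/- Let K₀ be any field and K = K₀(t) a rational function field in one variable. Then K is fully Hilbertian. -/

import Mathlib

open Polynomial

/-- The Hilbert set of `f(X,Y) ∈ K[X][Y]` (with `Y` the outer variable). -/
def HilbertSet {K : Type} [Field K] (f : Polynomial (Polynomial K)) : Set K :=
  {a : K | Irreducible (f.map (Polynomial.evalRingHom a))}

/-- `K` is fully Hilbertian (equivalent characterization by absolutely irreducible
polynomials): for every absolutely irreducible `f(X,Y) ∈ K[X,Y]` separable in `Y` there
are `|K|` many `a ∈ H(f)` and roots `b_a` of `f(a,Y)` such that the fields `K(b_a)` are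
linearly disjoint over `K`. -/
def IsFullyHilbertian (K : Type) [Field K] : Prop :=
  ∀ f : Polynomial (Polynomial K),
    Irreducible (f.map (Polynomial.mapRingHom (algebraMap K (AlgebraicClosure K)))) →
    f.derivative ≠ 0 →
    ∃ (A : Set K) (b : A → AlgebraicClosure K),
      A ⊆ HilbertSet f ∧ Cardinal.mk A = Cardinal.mk K ∧
      (∀ a : A, Polynomial.aeval (b a) (f.map (Polynomial.evalRingHom (a : K))) = 0) ∧
      (∀ a : A,
        (IntermediateField.adjoin K {b a}).LinearDisjoint
          ↥(⨆ (a' : A) (_ : a' ≠ a), IntermediateField.adjoin K {b a'}))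

section LocalRoots

variable {Ω : Type*} [Field Ω]

lemma exists_root_lift (q : Polynomial (PowerSeries Ω)) (hq : q.Monic) (ρ : Ω)
    (h0 : (q.map PowerSeries.constantCoeff).eval ρ = 0)
    (h1 : (q.map PowerSeries.constantCoeff).derivative.eval ρ ≠ 0) :
    ∃ β : PowerSeries Ω, q.eval β = 0 ∧ PowerSeries.constantCoeff β = ρ := by
  have key : ∀ (p : Polynomial (PowerSeries Ω)), PowerSeries.constantCoeff
      (p.eval (PowerSeries.C ρ)) = (p.map PowerSeries.constantCoeff).eval ρ := fun p ↦ by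
    rw [eval_map, ← Polynomial.eval₂_at_apply]; simp
  obtain ⟨β, hβ, hβ'⟩ := HenselianRing.is_henselian (I := Ideal.span {(PowerSeries.X : PowerSeries Ω)}) q hq
    (PowerSeries.C ρ) (by
      rw [Ideal.mem_span_singleton, PowerSeries.X_dvd_iff, key, h0]) (by
      apply IsUnit.map
      rw [PowerSeries.isUnit_iff_constantCoeff, key, ← derivative_map]
      exact isUnit_iff_ne_zero.mpr h1)
  refine ⟨β, hβ, ?_⟩
  rw [Ideal.mem_span_singleton, PowerSeries.X_dvd_iff, map_sub, sub_eq_zero] at hβ'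
  simpa using hβ'

lemma exists_eq_prod_X_sub_C [IsAlgClosed Ω] [DecidableEq Ω] (q : Polynomial (PowerSeries Ω))
    (hq : q.Monic) (hs : (q.map PowerSeries.constantCoeff).Separable) :
    ∃ β : Ω → PowerSeries Ω, (∀ ρ ∈ (q.map PowerSeries.constantCoeff).roots.toFinset,
      PowerSeries.constantCoeff (β ρ) = ρ) ∧
      q = ∏ ρ ∈ (q.map PowerSeries.constantCoeff).roots.toFinset, (X - C (β ρ) : Polynomial (PowerSeries Ω)) := by
  set R := (q.map PowerSeries.constantCoeff).roots.toFinset with hR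
  have hm := hq.map (PowerSeries.constantCoeff (R := Ω))
  have h : ∀ ρ : Ω, ∃ β : PowerSeries Ω, ρ ∈ R → q.eval β = 0 ∧ PowerSeries.constantCoeff β = ρ := by
    intro ρ
    by_cases hρ : ρ ∈ R
    · have h0 : (q.map PowerSeries.constantCoeff).eval ρ = 0 := by
        rw [hR, Multiset.mem_toFinset, mem_roots hm.ne_zero] at hρ
        exact hρ
      obtain ⟨β, hβ⟩ := exists_root_lift q hq ρ h0
        (by simpa [aeval_def, eval₂_eq_eval_map] using
          hs.aeval_derivative_ne_zero (x := ρ) (by simpa [aeval_def, eval₂_eq_eval_map] using h0))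
      exact ⟨β, fun _ ↦ hβ⟩
    · exact ⟨0, fun h ↦ absurd h hρ⟩
  choose β hβ using h
  refine ⟨β, fun ρ hρ ↦ (hβ ρ hρ).2, ?_⟩
  refine (eq_of_monic_of_dvd_of_natDegree_le (monic_prod_of_monic _ _ fun i _ ↦ monic_X_sub_C _)
    hq (Finset.prod_dvd_of_coprime ?_ ?_) ?_)
  · intro a ha b hb hab
    apply isCoprime_X_sub_C_of_isUnit_sub
    rw [PowerSeries.isUnit_iff_constantCoeff, map_sub, (hβ a ha).2, (hβ b hb).2]
    exact isUnit_iff_ne_zero.mpr (sub_ne_zero.mpr hab)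
  · intro a ha
    exact dvd_iff_isRoot.mpr (hβ a ha).1
  · rw [natDegree_prod_of_monic _ _ fun i _ ↦ monic_X_sub_C _]
    simp only [natDegree_X_sub_C, Finset.sum_const, smul_eq_mul, mul_one]
    rw [hR, Multiset.toFinset_card_of_nodup (nodup_roots hs),
      ← hq.natDegree_map (PowerSeries.constantCoeff (R := Ω))]
    exact (splits_iff_card_roots.mp (IsAlgClosed.splits _)).ge

/-- Newton iteration: a simple root of the fibre at the origin lifts to polynomial approximate
roots of any order. -/
lemma exists_approx_root (G : Polynomial (Polynomial (PowerSeries Ω))) (β : PowerSeries Ω)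
    (h0 : (G.map (evalRingHom 0)).eval β = 0)
    (h1 : PowerSeries.constantCoeff ((G.map (evalRingHom 0)).derivative.eval β) ≠ 0) (T : ℕ) :
    ∃ y : Polynomial (PowerSeries Ω), X ^ T ∣ G.eval y ∧ y.eval 0 = β := by
  have key : ∀ (p : Polynomial (Polynomial (PowerSeries Ω))) (y : Polynomial (PowerSeries Ω)),
      (p.eval y).eval 0 = (p.map (evalRingHom 0)).eval (y.eval 0) := fun p y ↦ by
    rw [eval_map, ← coe_evalRingHom, ← Polynomial.eval₂_at_apply]
  suffices H : ∀ T, ∃ y : Polynomial (PowerSeries Ω), X ^ (T + 1) ∣ G.eval y ∧ y.eval 0 = β by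
    obtain ⟨y, hy, hy'⟩ := H T
    exact ⟨y, (pow_dvd_pow _ (Nat.le_succ T)).trans hy, hy'⟩
  obtain ⟨c, hc⟩ := ((PowerSeries.isUnit_iff_constantCoeff).mpr (isUnit_iff_ne_zero.mpr h1)).exists_right_inv
  intro T
  induction T with
  | zero => exact ⟨C β, by simp [X_dvd_iff, coeff_zero_eq_eval_zero, key, h0]⟩
  | succ T ih =>
    obtain ⟨y, ⟨w, hw⟩, hy⟩ := ih
    obtain ⟨k, hk⟩ := G.binomExpansion y (-(C c * G.eval y))
    refine ⟨y - C c * G.eval y, ?_, ?_⟩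
    · obtain ⟨v, hv⟩ : (X : Polynomial (PowerSeries Ω)) ∣ 1 - C c * G.derivative.eval y := by
        rw [X_dvd_iff, coeff_zero_eq_eval_zero]
        simp only [eval_sub, eval_one, eval_mul, eval_C, key, hy, ← derivative_map]
        rw [mul_comm, hc, sub_self]
      have : G.eval (y - C c * G.eval y) = G.eval y * (1 - C c * G.derivative.eval y)
          + k * C c ^ 2 * G.eval y ^ 2 := by
        rw [sub_eq_add_neg, hk]; ring
      rw [this, hv, hw]
      exact ⟨w * v + k * C c ^ 2 * w ^ 2 * X ^ T, by ring⟩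
    · simp [key, hy, h0]

lemma constantCoeff_comp_evalRingHom {σ : PowerSeries Ω} (hσ : PowerSeries.constantCoeff σ = 0) :
    (PowerSeries.constantCoeff (R := Ω)).comp (evalRingHom σ) =
      (PowerSeries.constantCoeff (R := Ω)).comp (evalRingHom 0) := by
  ext <;> simp [hσ]

lemma prod_X_sub_C_dvd {q : Polynomial (PowerSeries Ω)} {β : Ω → PowerSeries Ω} {I : Finset Ω}
    (hI : ∀ ρ ∈ I, PowerSeries.constantCoeff (β ρ) = ρ) (h : ∀ ρ ∈ I, q.eval (β ρ) = 0) :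
    ∏ ρ ∈ I, (X - C (β ρ) : Polynomial (PowerSeries Ω)) ∣ q := by
  refine Finset.prod_dvd_of_coprime (fun a ha b hb hab ↦ ?_) fun a ha ↦ dvd_iff_isRoot.mpr (h a ha)
  apply isCoprime_X_sub_C_of_isUnit_sub
  rw [PowerSeries.isUnit_iff_constantCoeff, map_sub, hI a ha, hI b hb]
  exact isUnit_iff_ne_zero.mpr (sub_ne_zero.mpr hab)

lemma natDegree_prod_X_sub_C {A ι : Type*} [CommRing A] [Nontrivial A] (I : Finset ι) (β : ι → A) :
    (∏ i ∈ I, (X - C (β i))).natDegree = I.card := by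
  rw [natDegree_prod_of_monic _ _ fun i _ ↦ monic_X_sub_C _]
  simp

/-- Near the origin, the coefficients of the two factors in any monic factorization of a fibre of
`G` are given, to any order, by one of finitely many polynomials. -/
lemma exists_approx_factorization [IsAlgClosed Ω] [DecidableEq Ω]
    (G : Polynomial (Polynomial (PowerSeries Ω))) (hG : G.Monic)
    (hs : ((G.map (evalRingHom 0)).map (PowerSeries.constantCoeff (R := Ω))).Separable) (T : ℕ) :
    ∃ Φ : Finset Ω → Polynomial (Polynomial (PowerSeries Ω)),
      ∀ σ : PowerSeries Ω, PowerSeries.constantCoeff σ = 0 →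
      ∀ h h' : Polynomial (PowerSeries Ω), h.Monic → h'.Monic → h * h' = G.map (evalRingHom σ) →
      ∃ I ⊆ ((G.map (evalRingHom 0)).map (PowerSeries.constantCoeff (R := Ω))).roots.toFinset,
        h.natDegree = I.card ∧
        (∀ j, σ ^ T ∣ h.coeff j - ((Φ I).coeff j).eval σ) ∧
        ∀ j, σ ^ T ∣ h'.coeff j - ((Φ (((G.map (evalRingHom 0)).map
          (PowerSeries.constantCoeff (R := Ω))).roots.toFinset \ I)).coeff j).eval σ := by
  set R := ((G.map (evalRingHom 0)).map (PowerSeries.constantCoeff (R := Ω))).roots.toFinset with hR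
  obtain ⟨β₀, hβ₀, hprod₀⟩ := exists_eq_prod_X_sub_C _ (hG.map (evalRingHom 0)) hs
  rw [← hR] at hβ₀ hprod₀
  have hy : ∀ ρ, ∃ y : Polynomial (PowerSeries Ω), ρ ∈ R → X ^ T ∣ G.eval y ∧ y.eval 0 = β₀ ρ := by
    intro ρ
    by_cases hρ : ρ ∈ R
    · have h0 : (G.map (evalRingHom 0)).eval (β₀ ρ) = 0 := by
        rw [hprod₀, eval_prod]
        exact Finset.prod_eq_zero hρ (by simp)
      obtain ⟨y, hy⟩ := exists_approx_root G (β₀ ρ) h0 (by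
        have := hs.aeval_derivative_ne_zero (x := ρ) (by
          rw [aeval_def, eval₂_eq_eval_map, Algebra.algebraMap_self, Polynomial.map_id,
            ← hβ₀ ρ hρ, eval_map, Polynomial.eval₂_at_apply, h0, map_zero])
        rwa [aeval_def, eval₂_eq_eval_map, Algebra.algebraMap_self, Polynomial.map_id,
            ← hβ₀ ρ hρ, derivative_map, eval_map, Polynomial.eval₂_at_apply] at this) T
      exact ⟨y, fun _ ↦ hy⟩
    · exact ⟨0, fun h ↦ absurd h hρ⟩
  choose y hy using hy
  refine ⟨fun I ↦ ∏ ρ ∈ I, (X - C (y ρ)), fun σ hσ h h' hh hh' hmul ↦ ?_⟩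
  have hred : (G.map (evalRingHom σ)).map (PowerSeries.constantCoeff (R := Ω)) =
      (G.map (evalRingHom 0)).map (PowerSeries.constantCoeff (R := Ω)) := by
    rw [Polynomial.map_map, constantCoeff_comp_evalRingHom hσ, Polynomial.map_map]
  obtain ⟨β, hβ, hprod⟩ := exists_eq_prod_X_sub_C _ (hG.map (evalRingHom σ)) (hred ▸ hs)
  rw [hred, ← hR] at hβ hprod
  have happrox : ∀ ρ ∈ R, σ ^ T ∣ β ρ - (y ρ).eval σ := by
    intro ρ hρ
    have h1 : σ ^ T ∣ (G.map (evalRingHom σ)).eval ((y ρ).eval σ) := by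
      rw [eval_map, ← coe_evalRingHom, Polynomial.eval₂_at_apply, coe_evalRingHom]
      simpa using map_dvd (evalRingHom σ) (hy ρ hρ).1
    have h2 : PowerSeries.constantCoeff ((y ρ).eval σ) = ρ := by
      have := RingHom.congr_fun (constantCoeff_comp_evalRingHom hσ) (y ρ)
      simp only [RingHom.comp_apply, coe_evalRingHom] at this
      rw [this, (hy ρ hρ).2, hβ₀ ρ hρ]
    rw [hprod, eval_prod, ← Finset.mul_prod_erase _ _ hρ] at h1
    have h3 : IsUnit (∏ x ∈ R.erase ρ, eval (eval σ (y ρ)) (X - C (β x))) := by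
      rw [PowerSeries.isUnit_iff_constantCoeff, map_prod]
      refine isUnit_iff_ne_zero.mpr (Finset.prod_ne_zero_iff.mpr fun x hx ↦ ?_)
      rw [eval_sub, eval_X, eval_C, map_sub, h2, hβ x (Finset.mem_of_mem_erase hx)]
      exact sub_ne_zero.mpr (Finset.ne_of_mem_erase hx).symm
    rw [h3.dvd_mul_right] at h1
    rw [← dvd_neg]
    simpa using h1
  have hcoeff : ∀ I ⊆ R, ∀ j, σ ^ T ∣ (∏ ρ ∈ I, (X - C (β ρ) : Polynomial (PowerSeries Ω))).coeff j -
      ((∏ ρ ∈ I, (X - C (y ρ) : Polynomial (Polynomial (PowerSeries Ω)))).coeff j).eval σ := by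
    intro I hI j
    have : (∏ ρ ∈ I, (X - C (β ρ) : Polynomial (PowerSeries Ω))).map
        (Ideal.Quotient.mk (Ideal.span {σ ^ T})) =
        ((∏ ρ ∈ I, (X - C (y ρ) : Polynomial (Polynomial (PowerSeries Ω)))).map (evalRingHom σ)).map
        (Ideal.Quotient.mk (Ideal.span {σ ^ T})) := by
      simp only [Polynomial.map_prod, Polynomial.map_sub, map_X, map_C]
      refine Finset.prod_congr rfl fun ρ hρ ↦ ?_
      rw [(Ideal.Quotient.eq).mpr (Ideal.mem_span_singleton.mpr (happrox ρ (hI hρ))), coe_evalRingHom]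
    have := congrArg (fun p ↦ p.coeff j) this
    simp only [coeff_map] at this
    rwa [Ideal.Quotient.eq, Ideal.mem_span_singleton, coe_evalRingHom] at this
  have hroot : ∀ ρ ∈ R, h.eval (β ρ) = 0 ∨ h'.eval (β ρ) = 0 := by
    intro ρ hρ
    rw [← mul_eq_zero, ← eval_mul, hmul, hprod, eval_prod]
    exact Finset.prod_eq_zero hρ (by simp)
  classical
  have hd := prod_X_sub_C_dvd (q := h) (β := β) (I := R.filter fun ρ ↦ h.eval (β ρ) = 0)
    (fun ρ hρ ↦ hβ ρ (Finset.mem_filter.mp hρ).1) fun ρ hρ ↦ (Finset.mem_filter.mp hρ).2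
  have hd' := prod_X_sub_C_dvd (q := h') (β := β) (I := R \ R.filter fun ρ ↦ h.eval (β ρ) = 0)
    (fun ρ hρ ↦ hβ ρ (Finset.mem_sdiff.mp hρ).1) fun ρ hρ ↦ by
      simp only [Finset.mem_sdiff, Finset.mem_filter, not_and] at hρ
      exact (hroot ρ hρ.1).resolve_left (hρ.2 hρ.1)
  have hI : (R.filter fun ρ ↦ h.eval (β ρ) = 0) ⊆ R := Finset.filter_subset _ _
  set I := R.filter fun ρ ↦ h.eval (β ρ) = 0
  have e : h.natDegree + h'.natDegree = R.card := by
    rw [← hh.natDegree_mul hh', hmul, hprod, natDegree_prod_X_sub_C]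
  have e1 := natDegree_le_of_dvd hd hh.ne_zero
  have e2 := natDegree_le_of_dvd hd' hh'.ne_zero
  have e3 := Finset.card_sdiff_add_card_eq_card hI
  rw [natDegree_prod_X_sub_C] at e1 e2
  have E1 := eq_of_monic_of_dvd_of_natDegree_le (monic_prod_of_monic _ _ fun i _ ↦ monic_X_sub_C _)
    hh hd (by rw [natDegree_prod_X_sub_C]; omega)
  have E2 := eq_of_monic_of_dvd_of_natDegree_le (monic_prod_of_monic _ _ fun i _ ↦ monic_X_sub_C _)
    hh' hd' (by rw [natDegree_prod_X_sub_C]; omega)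
  refine ⟨I, hI, by omega, fun j ↦ ?_, fun j ↦ ?_⟩
  · rw [E1]; exact hcoeff I hI j
  · rw [E2]; exact hcoeff _ Finset.sdiff_subset j

end LocalRoots

section Determinant

lemma sum_range_card_le_sum {ι : Type*} [Fintype ι] (f : ι → ℕ) (hf : Function.Injective f) :
    ∑ i ∈ Finset.range (Fintype.card ι), i ≤ ∑ i, f i := by
  classical
  have h := Finset.sum_range_le_sum (s := Finset.univ.map ⟨fun i ↦ (f i : ℤ), fun a b hab ↦
    hf (by simpa using hab)⟩) (c := 0) (by
      intro x hx
      obtain ⟨a, -, rfl⟩ := Finset.mem_map.mp hx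
      exact Int.natCast_nonneg _)
  simp only [Finset.card_map, Finset.card_univ, zero_add, Finset.sum_map] at h
  change _ ≤ ∑ i, (f i : ℤ) at h
  zify
  exact h

/-- A generalized Vandermonde determinant at points divisible by `τ` is highly divisible
by `τ`. -/
lemma pow_dvd_det_eval {S ι : Type*} [CommRing S] [Fintype ι] [DecidableEq ι] (Φ : ι → S[X])
    (σ : ι → S) (τ : S) (h : ∀ l, τ ∣ σ l) :
    τ ^ (∑ i ∈ Finset.range (Fintype.card ι), i) ∣ (Matrix.of fun i l ↦ (Φ i).eval (σ l)).det := by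
  choose w hw using h
  set D := Finset.univ.sup fun i ↦ (Φ i).natDegree + 1
  have hD : ∀ i, (Φ i).natDegree < D := fun i ↦
    Nat.lt_of_succ_le (Finset.le_sup (f := fun i ↦ (Φ i).natDegree + 1) (Finset.mem_univ i))
  have hrow : (Matrix.of fun i l ↦ (Φ i).eval (σ l)) =
      fun i ↦ ∑ j ∈ Finset.range D, ((Φ i).coeff j * τ ^ j) • fun l ↦ w l ^ j := by
    ext i l
    simp only [Matrix.of_apply, Finset.sum_apply, Pi.smul_apply, smul_eq_mul]
    rw [eval_eq_sum_range' (hD i)]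
    refine Finset.sum_congr rfl fun j _ ↦ ?_
    rw [hw, mul_pow, mul_assoc]
  have hdet : (Matrix.of fun i l ↦ (Φ i).eval (σ l)).det =
      (Matrix.detRowAlternating (R := S) (n := ι)).toMultilinearMap
        (fun i ↦ ∑ j ∈ Finset.range D, ((Φ i).coeff j * τ ^ j) • fun l ↦ w l ^ j) := by
    rw [← hrow]; rfl
  rw [hdet, MultilinearMap.map_sum_finset]
  refine Finset.dvd_sum fun f _ ↦ ?_
  rw [MultilinearMap.map_smul_univ, smul_eq_mul]
  by_cases hf : Function.Injective f
  · refine Dvd.dvd.mul_right ?_ _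
    rw [Finset.prod_mul_distrib, Finset.prod_pow_eq_pow_sum]
    exact Dvd.dvd.mul_left (pow_dvd_pow _ (sum_range_card_le_sum f hf)) _
  · have : (Matrix.detRowAlternating (R := S) (n := ι)).toMultilinearMap
        (fun i l ↦ w l ^ f i) = 0 := by
      refine AlternatingMap.map_eq_zero_of_not_injective Matrix.detRowAlternating _ fun hinj ↦ hf ?_
      intro a b hab
      exact hinj (by simp [hab])
    rw [this, mul_zero]
    exact dvd_zero _

lemma natDegree_det_le {R ι : Type*} [CommRing R] [Fintype ι] [DecidableEq ι] (M : Matrix ι ι R[X])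
    (d : ι → ℕ) (h : ∀ i l, (M i l).natDegree ≤ d i) : M.det.natDegree ≤ ∑ i, d i := by
  rw [← Matrix.det_transpose, Matrix.det_apply]
  refine natDegree_sum_le_of_forall_le _ _ fun σ _ ↦ ?_
  refine (natDegree_smul_le _ _).trans ((natDegree_prod_le _ _).trans ?_)
  exact Finset.sum_le_sum fun i _ ↦ h _ _

lemma exists_dotProduct_eq_zero {R ι : Type*} [CommRing R] [IsDomain R] [Fintype ι] [DecidableEq ι]
    (V : Set (ι → R)) (h : ∀ v : ι → ι → R, (∀ l, v l ∈ V) → (Matrix.of v).det = 0) :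
    ∃ w : ι → R, w ≠ 0 ∧ ∀ v ∈ V, ∑ i, w i * v i = 0 := by
  let F := FractionRing R
  let φ : (ι → R) → (ι → F) := fun v i ↦ algebraMap R F (v i)
  have hlt : Submodule.span F (φ '' V) < ⊤ := by
    rw [lt_top_iff_ne_top]
    intro htop
    obtain ⟨f, hf, -, hli⟩ := Submodule.exists_fun_fin_finrank_span_eq F (φ '' V)
    have hcard : Module.finrank F (Submodule.span F (φ '' V)) = Fintype.card ι := by
      rw [htop, finrank_top, Module.finrank_fintype_fun_eq_card]
    let e : ι ≃ Fin (Module.finrank F (Submodule.span F (φ '' V))) :=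
      (Fintype.equivFin ι).trans (finCongr hcard.symm)
    choose v hv hv' using hf
    have h1 := h (fun i ↦ v (e i)) fun i ↦ hv _
    have h2 : IsUnit (Matrix.of fun i ↦ f (e i)) :=
      Matrix.linearIndependent_rows_iff_isUnit.mp (hli.comp e e.injective)
    rw [Matrix.isUnit_iff_isUnit_det] at h2
    apply h2.ne_zero
    have : (Matrix.of fun i ↦ f (e i)) = (algebraMap R F).mapMatrix (Matrix.of fun i ↦ v (e i)) := by
      ext i j
      simp [← hv', φ]
    rw [this, ← RingHom.map_det, h1, map_zero]
  obtain ⟨g, hg, hker⟩ := Submodule.exists_le_ker_of_lt_top _ hlt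
  obtain ⟨b, hb⟩ := IsLocalization.exist_integer_multiples_of_finite (nonZeroDivisors R)
    fun i ↦ g (Pi.single i 1)
  choose w hw using hb
  have hb0 : algebraMap R F b ≠ 0 :=
    IsFractionRing.to_map_ne_zero_of_mem_nonZeroDivisors b.2
  have hgv : ∀ x : ι → F, g x = ∑ i, x i * g (Pi.single i 1) := fun x ↦ by
    conv_lhs => rw [pi_eq_sum_univ' x, map_sum]
    refine Finset.sum_congr rfl fun i _ ↦ ?_
    rw [map_smul, smul_eq_mul]
  refine ⟨w, fun hw0 ↦ hg (LinearMap.ext fun x ↦ ?_), fun v hv ↦ ?_⟩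
  · rw [hgv]
    refine Finset.sum_eq_zero fun i _ ↦ ?_
    have := hw i
    rw [hw0, Pi.zero_apply, map_zero, Algebra.smul_def, eq_comm, mul_eq_zero] at this
    rw [this.resolve_left hb0, mul_zero]
  · apply IsFractionRing.injective R F
    have h3 : g (φ v) = 0 := hker (Submodule.subset_span ⟨v, hv, rfl⟩)
    rw [hgv] at h3
    rw [map_zero, map_sum, ← mul_zero (algebraMap R F b), ← h3, Finset.mul_sum]
    refine Finset.sum_congr rfl fun i _ ↦ ?_
    rw [map_mul, hw, Algebra.smul_def]
    ring

end Determinant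

section Interpolation

/-- If `z s` is approximated to high order by a fixed analytic function of `s`, for points `s` that
are `τ`-adically small but of small degree, then `z` satisfies a linear relation over `s`. -/
lemma exists_linear_relation {k S : Type*} [Field k] [CommRing S] (ι : k[X] →+* S) (τ : S) (π : ℕ)
    (hπ : ∀ p : k[X], p ≠ 0 → ∀ m, τ ^ m ∣ ι p → m * π ≤ p.natDegree) (e c r n : ℕ)
    (hn : n * (e + c) < r * π * (2 * e + 1)) (E : Set k[X]) (z : k[X] → k[X]) (Φ : S[X])
    (hdeg : ∀ s ∈ E, s.natDegree ≤ n) (hdvd : ∀ s ∈ E, τ ^ r ∣ ι s)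
    (hz : ∀ s ∈ E, (z s).natDegree ≤ c * n)
    (hΦ : ∀ s ∈ E, ι s ^ ((e + 1) * (2 * e + 1)) ∣ ι (z s) - Φ.eval (ι s)) :
    ∃ A B : k[X][X], (A ≠ 0 ∨ B ≠ 0) ∧ A.natDegree ≤ e ∧ B.natDegree ≤ e ∧
      ∀ s ∈ E, A.eval s + B.eval s * z s = 0 := by
  let vec : k[X] → Fin (e + 1) ⊕ Fin (e + 1) → k[X] :=
    fun s ↦ Sum.elim (fun i ↦ s ^ (i : ℕ)) fun i ↦ s ^ (i : ℕ) * z s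
  have hsum : ∑ i ∈ Finset.range (Fintype.card (Fin (e + 1) ⊕ Fin (e + 1))), i =
      (e + 1) * (2 * e + 1) := by
    rw [Finset.sum_range_id, Fintype.card_sum, Fintype.card_fin]
    apply Nat.div_eq_of_eq_mul_left two_pos
    rw [show e + 1 + (e + 1) - 1 = 2 * e + 1 by omega]
    ring
  obtain ⟨w, hw, hw'⟩ := exists_dotProduct_eq_zero (vec '' E) fun v hv ↦ by
    choose s hs hsv using hv
    obtain rfl : (fun l ↦ vec (s l)) = v := funext hsv
    rw [← Matrix.det_transpose]
    by_contra hne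
    have hd := natDegree_det_le (Matrix.of fun l ↦ vec (s l)).transpose
      (Sum.elim (fun i : Fin (e + 1) ↦ n * i) fun i ↦ n * i + c * n) (by
        have hpow : ∀ l (i : ℕ), (s l ^ i).natDegree ≤ n * i := fun l i ↦
          (natDegree_pow_le_of_le _ (hdeg _ (hs l))).trans (mul_comm _ _).le
        rintro (i | i) l
        · exact hpow l i
        · exact natDegree_mul_le_of_le (hpow l i) (hz _ (hs l)))
    have hdvd' : (τ ^ r) ^ ((e + 1) * (2 * e + 1)) ∣
        ι (Matrix.of fun l ↦ vec (s l)).transpose.det := by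
      have h1 := pow_dvd_det_eval (Sum.elim (fun i : Fin (e + 1) ↦ X ^ (i : ℕ))
        fun i : Fin (e + 1) ↦ X ^ (i : ℕ) * Φ) (fun l ↦ ι (s l)) (τ ^ r) fun l ↦ hdvd _ (hs l)
      rw [hsum] at h1
      rw [← Ideal.mem_span_singleton, ← Ideal.Quotient.eq_zero_iff_mem] at h1 ⊢
      rw [← h1, RingHom.map_det, RingHom.map_det, RingHom.map_det]
      congr 1
      ext i l
      simp only [RingHom.mapMatrix_apply, Matrix.map_apply, Matrix.transpose_apply, Matrix.of_apply]
      rcases i with i | i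
      · simp [vec]
      · simp only [vec, Sum.elim_inr, map_mul, map_pow, eval_mul, eval_pow, eval_X]
        congr 1
        rw [Ideal.Quotient.eq, Ideal.mem_span_singleton]
        exact (pow_dvd_pow_of_dvd (hdvd _ (hs l)) _).trans (hΦ _ (hs l))
    rw [← pow_mul] at hdvd'
    have := (hπ _ hne _ hdvd').trans hd
    simp only [Fintype.sum_sum_type, Sum.elim_inl, Sum.elim_inr, Finset.sum_add_distrib,
      ← Finset.mul_sum, Finset.sum_const, Finset.card_univ, Fintype.card_fin, smul_eq_mul] at this
    rw [Fin.sum_univ_eq_sum_range (fun i ↦ i)] at this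
    have h2 := Finset.sum_range_id_mul_two (e + 1)
    simp only [add_tsub_cancel_right] at h2
    have h3 := Nat.mul_lt_mul_of_pos_left hn (Nat.succ_pos e)
    nlinarith
  let P : (Fin (e + 1) → k[X]) → k[X][X] := fun u ↦ ∑ i, C (u i) * X ^ (i : ℕ)
  have hPdeg : ∀ u, (P u).natDegree ≤ e := fun u ↦ natDegree_sum_le_of_forall_le _ _ fun i _ ↦
    (natDegree_C_mul_X_pow_le _ _).trans (Nat.lt_succ_iff.mp i.2)
  have hP0 : ∀ u, P u = 0 → u = 0 := fun u hu ↦ by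
    ext1 i
    have := congrArg (fun p ↦ p.coeff i) hu
    simpa [P, coeff_X_pow, Fin.val_inj, Finset.sum_ite_eq] using this
  refine ⟨P fun i ↦ w (Sum.inl i), P fun i ↦ w (Sum.inr i), ?_, hPdeg _, hPdeg _, fun s hs ↦ ?_⟩
  · by_contra! h
    apply hw
    ext1 i
    rcases i with i | i
    · exact congrFun (hP0 _ h.1) i
    · exact congrFun (hP0 _ h.2) i
  · have := hw' _ ⟨s, hs, rfl⟩
    simp only [Fintype.sum_sum_type, vec, Sum.elim_inl, Sum.elim_inr] at this
    simp only [P, eval_finsetSum, eval_mul, eval_C, eval_pow, eval_X, Finset.sum_mul]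
    rw [← this]
    congr 1
    exact Finset.sum_congr rfl fun i _ ↦ by ring

end Interpolation

section Patching

variable {R : Type*} [CommRing R] [IsDomain R]

lemma exists_common_denominator {E : Finset R} {e : ℕ} (hE : e < E.card) (d : ℕ) (z : ℕ → R → R)
    (h : ∀ j, ∃ A B : R[X], (A ≠ 0 ∨ B ≠ 0) ∧ A.natDegree ≤ e ∧ B.natDegree ≤ e ∧
      ∀ s ∈ E, A.eval s + B.eval s * z j s = 0) :
    ∃ (D : R[X]) (U : ℕ → R[X]), D ≠ 0 ∧ D.natDegree ≤ d * e ∧ ∀ j < d, (U j).natDegree ≤ d * e ∧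
      ∀ s ∈ E, D.eval s * z j s = (U j).eval s := by
  choose A B hAB hA hB hz using h
  have hB0 : ∀ j, B j ≠ 0 := by
    intro j hj
    refine (hAB j).resolve_right (not_not.mpr hj) ?_
    refine eq_zero_of_natDegree_lt_card_of_eval_eq_zero' _ E (fun s hs ↦ ?_) ((hA j).trans_lt hE)
    simpa [hj] using hz j s hs
  refine ⟨∏ j ∈ Finset.range d, B j, fun j ↦ -A j * ∏ i ∈ (Finset.range d).erase j, B i,
    Finset.prod_ne_zero_iff.mpr fun j _ ↦ hB0 j, ?_, fun j hj ↦ ⟨?_, fun s hs ↦ ?_⟩⟩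
  · refine (natDegree_prod_le _ _).trans ((Finset.sum_le_sum fun j _ ↦ hB j).trans ?_)
    simp
  · refine natDegree_mul_le.trans ((add_le_add ((natDegree_neg _).trans_le (hA j))
      ((natDegree_prod_le _ _).trans (Finset.sum_le_sum fun j _ ↦ hB j))).trans ?_)
    rw [Finset.sum_const, Finset.card_erase_of_mem (Finset.mem_range.mpr hj), Finset.card_range,
      smul_eq_mul]
    obtain ⟨d, rfl⟩ := Nat.exists_eq_succ_of_ne_zero (Nat.ne_zero_of_lt hj)
    simp only [Nat.succ_eq_add_one, add_tsub_cancel_right]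
    linarith
  · rw [← Finset.mul_prod_erase _ _ (Finset.mem_range.mpr hj)]
    simp only [eval_mul, eval_neg]
    linear_combination (∏ i ∈ (Finset.range d).erase j, B i).eval s * hz j s hs

/-- An irreducible polynomial over `R[X]` has only boundedly many specializations with a
factorization whose coefficients satisfy linear relations of bounded degree. -/
lemma exists_card_le_of_linear_relations (g : R[X][X]) (hg : g.Monic) (hp : Prime g) (e : ℕ) :
    ∃ N, ∀ (E : Finset R) (h h' : R → R[X]),
      (∀ s ∈ E, h s * h' s = g.map (evalRingHom s) ∧ (h s).natDegree < g.natDegree ∧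
        (h' s).natDegree < g.natDegree) →
      (∀ j, ∃ A B : R[X], (A ≠ 0 ∨ B ≠ 0) ∧ A.natDegree ≤ e ∧ B.natDegree ≤ e ∧
        ∀ s ∈ E, A.eval s + B.eval s * (h s).coeff j = 0) →
      (∀ j, ∃ A B : R[X], (A ≠ 0 ∨ B ≠ 0) ∧ A.natDegree ≤ e ∧ B.natDegree ≤ e ∧
        ∀ s ∈ E, A.eval s + B.eval s * (h' s).coeff j = 0) → E.card ≤ N := by
  set d := g.natDegree with hd
  let M := g.support.sup fun j ↦ (g.coeff j).natDegree
  have hM : ∀ j, (g.coeff j).natDegree ≤ M := fun j ↦ by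
    by_cases hj : j ∈ g.support
    · exact Finset.le_sup (f := fun j ↦ (g.coeff j).natDegree) hj
    · simp [notMem_support_iff.mp hj]
  refine ⟨max e (d * e + d * e + M), fun E h h' hE hA hA' ↦ ?_⟩
  by_contra! hcard
  rw [max_lt_iff] at hcard
  obtain ⟨D, U, hD0, hD, hU⟩ := exists_common_denominator hcard.1 d _ hA
  obtain ⟨D', U', hD0', hD', hU'⟩ := exists_common_denominator hcard.1 d _ hA'
  let Q : (ℕ → R[X]) → R[X][X] := fun U ↦ ∑ j ∈ Finset.range d, C (U j) * X ^ j
  have hQcoeff : ∀ U j, (Q U).coeff j = if j < d then U j else 0 := fun U j ↦ by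
    simp [Q, coeff_X_pow]
  have hQdeg : ∀ U, (Q U).degree < g.degree := fun U ↦ by
    rw [degree_eq_natDegree hg.ne_zero, ← hd, degree_lt_iff_coeff_zero]
    intro m hm
    rw [hQcoeff, if_neg (not_lt.mpr hm)]
  have hmap : ∀ (U : ℕ → R[X]) (D : R[X]) (h : R → R[X]), (∀ s ∈ E, (h s).natDegree < d) →
      (∀ j < d, (U j).natDegree ≤ d * e ∧ ∀ s ∈ E, D.eval s * (h s).coeff j = (U j).eval s) →
      ∀ s ∈ E, (Q U).map (evalRingHom s) = C (D.eval s) * h s := by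
    intro U D h hE hU s hs
    ext1 j
    rw [coeff_map, hQcoeff, coeff_C_mul]
    split_ifs with hj
    · exact ((hU j hj).2 s hs).symm
    · rw [coeff_eq_zero_of_natDegree_lt ((hE s hs).trans_le (not_lt.mp hj)), map_zero, mul_zero]
  have hcoeffdeg : ∀ U : ℕ → R[X], (∀ j < d, (U j).natDegree ≤ d * e) →
      ∀ j, ((Q U).coeff j).natDegree ≤ d * e := by
    intro U hU j
    rw [hQcoeff]
    split_ifs with hj
    · exact hU j hj
    · simp
  have key : C (D * D') * g - Q U * Q U' = 0 := by
    ext1 m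
    rw [coeff_zero]
    refine eq_zero_of_natDegree_lt_card_of_eval_eq_zero' _ E (fun s hs ↦ ?_)
      (lt_of_le_of_lt ?_ hcard.2)
    · have h0 : (C (D * D') * g - Q U * Q U').map (evalRingHom s) = 0 := by
        rw [Polynomial.map_sub, Polynomial.map_mul, Polynomial.map_mul,
          hmap U D h (fun s hs ↦ (hE s hs).2.1) hU s hs,
          hmap U' D' h' (fun s hs ↦ (hE s hs).2.2) hU' s hs, ← (hE s hs).1, map_C,
          coe_evalRingHom, eval_mul, C_mul]
        ring
      rw [← coe_evalRingHom, ← coeff_map, h0, coeff_zero]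
    · rw [coeff_sub, coeff_C_mul, coeff_mul]
      refine (natDegree_sub_le _ _).trans (max_le ?_ ?_)
      · exact natDegree_mul_le_of_le (natDegree_mul_le_of_le hD hD') (hM m)
      · refine natDegree_sum_le_of_forall_le _ _ fun x _ ↦ ?_
        refine (natDegree_mul_le_of_le (hcoeffdeg U (fun j hj ↦ (hU j hj).1) _)
          (hcoeffdeg U' (fun j hj ↦ (hU' j hj).1) _)).trans (Nat.le_add_right _ _)
  rw [sub_eq_zero] at key
  have hne : Q U * Q U' ≠ 0 := by
    rw [← key]
    exact mul_ne_zero (C_ne_zero.mpr (mul_ne_zero hD0 hD0')) hg.ne_zero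
  rcases hp.dvd_or_dvd (key ▸ dvd_mul_left g _) with h1 | h1
  · exact left_ne_zero_of_mul hne (eq_zero_of_dvd_of_degree_lt h1 (hQdeg U))
  · exact right_ne_zero_of_mul hne (eq_zero_of_dvd_of_degree_lt h1 (hQdeg U'))

end Patching

section LocalExpansion

variable {k Ω : Type*} [Field k] [Field Ω] [Algebra k Ω]

/-- The expansion of a polynomial at a point `t₀` as a power series. -/
noncomputable def localExpansion (k : Type*) {Ω : Type*} [Field k] [Field Ω] [Algebra k Ω]
    (t₀ : Ω) : k[X] →+* PowerSeries Ω :=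
  (coeToPowerSeries.ringHom.comp (taylorAlgHom t₀).toRingHom).comp (mapRingHom (algebraMap k Ω))

lemma localExpansion_apply (t₀ : Ω) (p : k[X]) :
    localExpansion k t₀ p =
      ((taylor t₀ (p.map (algebraMap k Ω)) : Polynomial Ω) : PowerSeries Ω) := rfl

lemma constantCoeff_localExpansion (t₀ : Ω) (p : k[X]) :
    PowerSeries.constantCoeff (localExpansion k t₀ p) = aeval t₀ p := by
  rw [← PowerSeries.coeff_zero_eq_constantCoeff_apply, localExpansion_apply, coeff_coe,
    taylor_coeff_zero, eval_map_algebraMap]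

lemma coeff_one_localExpansion (t₀ : Ω) (p : k[X]) :
    PowerSeries.coeff 1 (localExpansion k t₀ p) = aeval t₀ p.derivative := by
  rw [localExpansion_apply, coeff_coe, taylor_coeff_one, derivative_map, eval_map_algebraMap]

lemma X_dvd_localExpansion_minpoly (t₀ : Ω) :
    PowerSeries.X ∣ localExpansion k t₀ (minpoly k t₀) := by
  rw [PowerSeries.X_dvd_iff, constantCoeff_localExpansion, minpoly.aeval]

lemma mul_natDegree_minpoly_le {t₀ : Ω} (ht₀ : IsSeparable k t₀) {m : ℕ} {p : k[X]}
    (hp : p ≠ 0) (h : PowerSeries.X ^ m ∣ localExpansion k t₀ p) :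
    m * (minpoly k t₀).natDegree ≤ p.natDegree := by
  obtain ⟨u, hu⟩ := X_dvd_localExpansion_minpoly (k := k) t₀
  have hu0 : IsUnit u := by
    rw [PowerSeries.isUnit_iff_constantCoeff, isUnit_iff_ne_zero]
    have h1 := coeff_one_localExpansion t₀ (minpoly k t₀)
    rw [hu, ← zero_add 1, PowerSeries.coeff_succ_X_mul,
      PowerSeries.coeff_zero_eq_constantCoeff_apply] at h1
    rw [h1]
    exact Separable.aeval_derivative_ne_zero ht₀ (minpoly.aeval k t₀)
  induction m generalizing p with
  | zero => simp
  | succ m ih =>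
    have h0 : aeval t₀ p = 0 := by
      rw [← constantCoeff_localExpansion, ← PowerSeries.X_dvd_iff]
      exact (dvd_pow_self _ m.succ_ne_zero).trans h
    obtain ⟨q, rfl⟩ := minpoly.dvd k t₀ h0
    rw [map_mul, hu, pow_succ', mul_assoc] at h
    have h2 := (mul_dvd_mul_iff_left PowerSeries.X_ne_zero).mp h
    rw [hu0.dvd_mul_left] at h2
    have h3 := ih (right_ne_zero_of_mul hp) h2
    rw [natDegree_mul (left_ne_zero_of_mul hp) (right_ne_zero_of_mul hp), add_mul, one_mul,
      add_comm]
    exact Nat.add_le_add_left h3 _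

end LocalExpansion

section InnerDegree

lemma natDegree_coeff_le_natDegree_swap {k : Type*} [CommRing k] (p : k[X][X]) (j : ℕ) :
    (p.coeff j).natDegree ≤ (Bivariate.swap p).natDegree := by
  rw [← Bivariate.swap_swap_apply p, Bivariate.swap_swap_apply (Bivariate.swap p)]
  set q := Bivariate.swap p
  conv_lhs => rw [q.as_sum_support, map_sum, finsetSum_coeff]
  refine natDegree_sum_le_of_forall_le _ _ fun i hi ↦ ?_
  rw [Bivariate.swap_monomial, coeff_mul_C, coeff_map]
  exact (natDegree_C_mul_X_pow_le _ _).trans (le_natDegree_of_mem_supp _ hi)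

lemma natDegree_swap_le {k : Type*} [CommRing k] (p : k[X][X]) (N : ℕ)
    (h : ∀ j, (p.coeff j).natDegree ≤ N) : (Bivariate.swap p).natDegree ≤ N := by
  rw [p.as_sum_support, map_sum]
  refine natDegree_sum_le_of_forall_le _ _ fun i _ ↦ ?_
  rw [Bivariate.swap_monomial]
  exact (natDegree_mul_C_le _ _).trans ((natDegree_map_le).trans (h i))

lemma natDegree_coeff_le_of_mul_eq {k : Type*} [CommRing k] [IsDomain k] {p q r : k[X][X]}
    (hr : r ≠ 0) (hpq : p * q = r) {N : ℕ} (h : ∀ j, (r.coeff j).natDegree ≤ N) (j : ℕ) :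
    (p.coeff j).natDegree ≤ N ∧ (q.coeff j).natDegree ≤ N := by
  have h1 := natDegree_swap_le r N h
  subst hpq
  rw [map_mul, natDegree_mul (by simpa using left_ne_zero_of_mul hr)
    (by simpa using right_ne_zero_of_mul hr)] at h1
  have h2 := natDegree_coeff_le_natDegree_swap p j
  have h3 := natDegree_coeff_le_natDegree_swap q j
  omega

lemma exists_natDegree_coeff_map_eval_le {k : Type*} [CommRing k] (g : k[X][X][X]) :
    ∃ c, ∀ (s : k[X]) (n : ℕ), 1 ≤ n → s.natDegree ≤ n → ∀ j,
      ((g.map (evalRingHom s)).coeff j).natDegree ≤ c * n := by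
  have h1 : ∀ p : k[X][X], ∃ c, ∀ (s : k[X]) (n : ℕ), 1 ≤ n → s.natDegree ≤ n →
      (p.eval s).natDegree ≤ c * n := by
    intro p
    refine ⟨p.natDegree + p.support.sup fun j ↦ (p.coeff j).natDegree, fun s n hn hs ↦ ?_⟩
    rw [eval_eq_sum, Polynomial.sum]
    refine natDegree_sum_le_of_forall_le _ _ fun i hi ↦ ?_
    refine (natDegree_mul_le_of_le (Finset.le_sup (f := fun j ↦ (p.coeff j).natDegree) hi)
      (natDegree_pow_le_of_le _ hs)).trans ?_
    have := le_natDegree_of_mem_supp _ hi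
    nlinarith
  choose c hc using h1
  refine ⟨g.support.sup fun j ↦ c (g.coeff j), fun s n hn hs j ↦ ?_⟩
  rw [coeff_map, coe_evalRingHom]
  by_cases hj : j ∈ g.support
  · refine (hc _ s n hn hs).trans (Nat.mul_le_mul_right _ ?_)
    exact Finset.le_sup (f := fun j ↦ c (g.coeff j)) hj
  · simp [notMem_support_iff.mp hj]

end InnerDegree

section FewReducible

variable {k Ω : Type*} [Field k] [Field Ω] [IsAlgClosed Ω] [Algebra k Ω]

lemma exists_monic_factorization {A : Type*} [CommRing A] [IsDomain A] {p : A[X]}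
    (hp : p.Monic) (hp0 : 0 < p.natDegree) (h : ¬ Irreducible p) :
    ∃ a b : A[X], a.Monic ∧ b.Monic ∧ a * b = p ∧ a.natDegree < p.natDegree ∧
      b.natDegree < p.natDegree := by
  rw [hp.irreducible_iff_natDegree'] at h
  push Not at h
  obtain ⟨a, b, ha, hb, hab, hmem⟩ := h (by rintro rfl; simp at hp0)
  rw [Finset.mem_Ioc] at hmem
  refine ⟨a, b, ha, hb, hab, ?_, by omega⟩
  have := ha.natDegree_mul hb
  rw [hab] at this
  omega

/-- Away from `0` few `t₀`-adically small polynomials of small degree give a reducible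
specialization. -/
lemma exists_card_not_irreducible_le (g : k[X][X][X]) (hg : g.Monic) (hirr : Irreducible g)
    (t₀ : Ω) (ht₀ : IsSeparable k t₀)
    (hs : ((g.map (evalRingHom 0)).map (aeval t₀ : k[X] →ₐ[k] Ω).toRingHom).Separable) :
    ∃ N, ∀ r n : ℕ, 1 ≤ r → 1 ≤ n → 2 * n ≤ 3 * (minpoly k t₀).natDegree * r →
      ∀ E : Finset k[X], (∀ s ∈ E, minpoly k t₀ ^ r ∣ s ∧ s.natDegree ≤ n ∧
        ¬ Irreducible (g.map (evalRingHom s))) → E.card ≤ N := by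
  classical
  obtain ⟨c, hc⟩ := exists_natDegree_coeff_map_eval_le g
  set e := 3 * c with he
  set ι := localExpansion k t₀ with hι
  set G := g.map (mapRingHom ι) with hG
  have hGm : G.Monic := hg.map _
  have hG0 : ∀ s, G.map (evalRingHom (ι s)) = (g.map (evalRingHom s)).map ι := by
    intro s
    rw [hG, Polynomial.map_map, Polynomial.map_map]
    congr 1
    exact Polynomial.ringHom_ext (fun a ↦ by simp) (by simp)
  have hGs : ((G.map (evalRingHom 0)).map (PowerSeries.constantCoeff (R := Ω))).Separable := by
    rw [← map_zero ι, hG0, Polynomial.map_map]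
    convert hs using 2
    ext x
    · simp [hι, constantCoeff_localExpansion]
    · simp [hι, constantCoeff_localExpansion]
  obtain ⟨Φ, hΦ⟩ := exists_approx_factorization G hGm hGs ((e + 1) * (2 * e + 1))
  obtain ⟨N, hN⟩ := exists_card_le_of_linear_relations g hg hirr.prime e
  set R := ((G.map (evalRingHom 0)).map (PowerSeries.constantCoeff (R := Ω))).roots.toFinset
  have hd : 0 < g.natDegree := Nat.pos_of_ne_zero fun h ↦
    hirr.not_isUnit (by rw [hg.natDegree_eq_zero.mp h]; exact isUnit_one)
  have hfac : ∀ s : k[X], ∃ a b : k[X][X], ¬ Irreducible (g.map (evalRingHom s)) →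
      a.Monic ∧ b.Monic ∧ a * b = g.map (evalRingHom s) ∧ a.natDegree < g.natDegree ∧
      b.natDegree < g.natDegree := by
    intro s
    by_cases h : Irreducible (g.map (evalRingHom s))
    · exact ⟨0, 0, fun h' ↦ absurd h h'⟩
    · obtain ⟨a, b, h⟩ := exists_monic_factorization (hg.map (evalRingHom s))
        (by rwa [hg.natDegree_map]) h
      rw [hg.natDegree_map] at h
      exact ⟨a, b, fun _ ↦ h⟩
  choose a b hab using hfac
  refine ⟨∑ I ∈ R.powerset, N, fun r n hr hn hrn E hE ↦ ?_⟩
  have hι0 : ∀ s ∈ E, PowerSeries.X ^ r ∣ ι s := fun s hs ↦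
    (pow_dvd_pow_of_dvd (X_dvd_localExpansion_minpoly t₀) r).trans
      (by rw [← map_pow]; exact map_dvd ι (hE s hs).1)
  have htype : ∀ s ∈ E, ∃ I ∈ R.powerset,
      (∀ j, ι s ^ ((e + 1) * (2 * e + 1)) ∣ ι ((a s).coeff j) - ((Φ I).coeff j).eval (ι s)) ∧
      ∀ j, ι s ^ ((e + 1) * (2 * e + 1)) ∣
        ι ((b s).coeff j) - ((Φ (R \ I)).coeff j).eval (ι s) := by
    intro s hs
    obtain ⟨ha, hb, hmul, -, -⟩ := hab s (hE s hs).2.2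
    obtain ⟨I, hI, -, h1, h2⟩ := hΦ (ι s)
      (by
        rw [← PowerSeries.X_dvd_iff]
        exact (dvd_pow_self _ (by omega)).trans (hι0 s hs))
      ((a s).map ι) ((b s).map ι) (ha.map _) (hb.map _)
      (by rw [hG0, ← Polynomial.map_mul, hmul])
    simp only [coeff_map] at h1 h2
    exact ⟨I, Finset.mem_powerset.mpr hI, h1, h2⟩
  choose! I hI hIa hIb using htype
  rw [Finset.card_eq_sum_card_fiberwise hI]
  refine Finset.sum_le_sum fun J hJ ↦ hN _ a b (fun s hs ↦ ?_) ?_ ?_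
  · exact (hab s (hE s (Finset.mem_filter.mp hs).1).2.2).2.2
  all_goals
    intro j
    have hfac : ∀ s ∈ E, ((a s).coeff j).natDegree ≤ c * n ∧ ((b s).coeff j).natDegree ≤ c * n :=
      fun s hs ↦ natDegree_coeff_le_of_mul_eq (hg.map (evalRingHom s)).ne_zero
        (hab s (hE s hs).2.2).2.2.1 (hc s n hn (hE s hs).2.1) j
    have hnum : n * (e + c) < r * (minpoly k t₀).natDegree * (2 * e + 1) := by
      have h1 : 0 < (minpoly k t₀).natDegree := minpoly.natDegree_pos ht₀.isIntegral
      have h2 := Nat.mul_le_mul_left (2 * c) hrn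
      have h3 : 0 < r * (minpoly k t₀).natDegree := by positivity
      rw [he]
      nlinarith
  · simpa only [Finset.mem_filter, Set.mem_ofPred_eq] using exists_linear_relation ι PowerSeries.X _
      (fun p hp m ↦ mul_natDegree_minpoly_le ht₀ hp) e c r n hnum {s | s ∈ E ∧ I s = J}
      (fun s ↦ (a s).coeff j) ((Φ J).coeff j) (fun s hs ↦ (hE s hs.1).2.1)
      (fun s hs ↦ hι0 s hs.1) (fun s hs ↦ (hfac s hs.1).1) (fun s hs ↦ hs.2 ▸ hIa s hs.1 j)
  · simpa only [Finset.mem_filter, Set.mem_ofPred_eq] using exists_linear_relation ι PowerSeries.X _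
      (fun p hp m ↦ mul_natDegree_minpoly_le ht₀ hp) e c r n hnum {s | s ∈ E ∧ I s = J}
      (fun s ↦ (b s).coeff j) ((Φ (R \ J)).coeff j) (fun s hs ↦ (hE s hs.1).2.1)
      (fun s hs ↦ hι0 s hs.1) (fun s hs ↦ (hfac s hs.1).2) (fun s hs ↦ hs.2 ▸ hIb s hs.1 j)

end FewReducible

section Simultaneous

lemma exists_ne_zero_separable_map {A : Type*} [CommRing A] [IsDomain A] [IsIntegrallyClosed A]
    {g : A[X]} (hg : g.Monic) (hirr : Irreducible g) (hder : derivative g ≠ 0) :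
    ∃ δ : A, δ ≠ 0 ∧ ∀ {Ω : Type*} [Field Ω] (φ : A →+* Ω), φ δ ≠ 0 → (g.map φ).Separable := by
  let F := FractionRing A
  have hinj : Function.Injective (algebraMap A F) := IsFractionRing.injective A F
  have hsep : (g.map (algebraMap A F)).Separable := by
    rw [separable_iff_derivative_ne_zero
      ((hg.irreducible_iff_irreducible_map_fraction_map (K := F)).mp hirr), derivative_map]
    exact (Polynomial.map_ne_zero_iff hinj).mpr hder
  obtain ⟨a, b, hab⟩ := hsep
  obtain ⟨c, hcM, hc⟩ := IsLocalization.integerNormalization_spec (nonZeroDivisors A) a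
  obtain ⟨d, hdM, hd⟩ := IsLocalization.integerNormalization_spec (nonZeroDivisors A) b
  set a' := IsLocalization.integerNormalization (nonZeroDivisors A) a
  set b' := IsLocalization.integerNormalization (nonZeroDivisors A) b
  have key : C d * a' * g + C c * b' * derivative g = C (c * d) := by
    apply Polynomial.map_injective _ hinj
    simp only [Polynomial.map_add, Polynomial.map_mul, map_C, hc, hd, Algebra.smul_def,
      ← derivative_map, map_mul] at hab ⊢
    linear_combination C (algebraMap A F c) * C (algebraMap A F d) * hab
  refine ⟨c * d, mul_ne_zero (nonZeroDivisors.ne_zero hcM) (nonZeroDivisors.ne_zero hdM), ?_⟩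
  intro Ω _ φ hφ
  have h := congrArg (map φ) key
  simp only [Polynomial.map_add, Polynomial.map_mul, map_C, ← derivative_map] at h
  refine ⟨C (φ (c * d))⁻¹ * (C (φ d) * map φ a'), C (φ (c * d))⁻¹ * (C (φ c) * map φ b'), ?_⟩
  have h1 : (C (φ (c * d))⁻¹ * C (φ (c * d)) : Polynomial Ω) = 1 := by
    rw [← C_mul, inv_mul_cancel₀ hφ, C_1]
  linear_combination C (φ (c * d))⁻¹ * h + h1

variable {k : Type*} [Field k]

lemma exists_card_not_irreducible_add_le {Ω : Type*} [Field Ω] [IsAlgClosed Ω] [Algebra k Ω]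
    (g : k[X][X][X]) (hg : g.Monic) (hirr : Irreducible g) (x₀ : k[X])
    (t₀ : Ω) (ht₀ : IsSeparable k t₀)
    (hs : ((g.map (evalRingHom x₀)).map (aeval t₀ : k[X] →ₐ[k] Ω).toRingHom).Separable) :
    ∃ N, ∀ r n : ℕ, 1 ≤ r → 1 ≤ n → 2 * n ≤ 3 * (minpoly k t₀).natDegree * r →
      ∀ E : Finset k[X], (∀ s ∈ E, minpoly k t₀ ^ r ∣ s ∧ s.natDegree ≤ n ∧
        ¬ Irreducible (g.map (evalRingHom (s + x₀)))) → E.card ≤ N := by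
  have h : ∀ s, (g.map (taylorAlgHom x₀).toRingHom).map (evalRingHom s) =
      g.map (evalRingHom (s + x₀)) := fun s ↦ by
    rw [Polynomial.map_map]
    congr 1
    exact Polynomial.ringHom_ext (fun a ↦ by simp) (by simp)
  simp_rw [← h]
  refine exists_card_not_irreducible_le _ (hg.map _) ?_ t₀ ht₀ (by rwa [h, zero_add])
  exact (MulEquiv.irreducible_iff (Polynomial.mapEquiv (taylorEquiv x₀).toRingEquiv)).mpr hirr

open Cardinal in
lemma exists_notMem_of_mk_lt {α ι : Type} [Infinite α] (hι : #ι < #α) (F : ι → Set α)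
    (hF : ∀ i, (F i).Finite) (B : Set α) (hB : #B < #α) : ∃ x, x ∉ B ∧ ∀ i, x ∉ F i := by
  suffices h : #(B ∪ ⋃ i, F i : Set α) < #α by
    by_contra! hcon
    apply h.ne
    rw [show (B ∪ ⋃ i, F i : Set α) = Set.univ from Set.eq_univ_of_forall fun x ↦ ?_, mk_univ]
    by_cases hx : x ∈ B
    · exact Or.inl hx
    · obtain ⟨i, hi⟩ := hcon x hx
      exact Or.inr (Set.mem_iUnion_of_mem i hi)
  refine (mk_union_le _ _).trans_lt (add_lt_of_lt (aleph0_le_mk α) hB ?_)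
  rcases (aleph0_le_mk α).eq_or_lt with h | h
  · rw [← h] at hι ⊢
    have := lt_aleph0_iff_finite.mp hι
    exact lt_aleph0_iff_finite.mpr (Set.finite_iUnion hF).to_subtype
  · refine (mk_iUnion_le_sum_mk.trans (sum_le_sum _ (fun _ ↦ ℵ₀) fun i ↦ ?_)).trans_lt ?_
    · exact (lt_aleph0_iff_finite.mpr (hF i).to_subtype).le
    · rw [sum_const']
      exact mul_lt_of_lt (aleph0_le_mk α) hι h

open Cardinal in
/-- Simultaneous specialization over `k[t]`, for infinite `k`. -/
lemma exists_forall_irreducible_of_infinite {k ι : Type} [Field k] [Infinite k] (hι : #ι < #k)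
    (g : ι → k[X][X][X]) (hg : ∀ i, (g i).Monic) (hirr : ∀ i, Irreducible (g i))
    (hder : ∀ i, derivative (g i) ≠ 0) (B : Set k[X]) (hB : #B < #k) :
    ∃ a ∉ B, ∀ i, Irreducible ((g i).map (evalRingHom a)) := by
  choose δ hδ0 hδ using fun i ↦ exists_ne_zero_separable_map (hg i) (hirr i) (hder i)
  obtain ⟨x, -, hx⟩ := exists_notMem_of_mk_lt hι (fun i ↦ {x : k | (δ i).IsRoot (C x)})
    (fun i ↦ (finite_setOfPred_isRoot (hδ0 i)).preimage C_injective.injOn) ∅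
    (by simpa using (mk_ne_zero k).pos)
  obtain ⟨t, -, ht⟩ := exists_notMem_of_mk_lt hι (fun i ↦ {t : k | ((δ i).eval (C x)).IsRoot t})
    (fun i ↦ finite_setOfPred_isRoot (hx i)) ∅ (by simpa using (mk_ne_zero k).pos)
  let Ω := AlgebraicClosure k
  have hmin : minpoly k (algebraMap k Ω t) = X - C t := minpoly.eq_X_sub_C Ω t
  choose N hN using fun i ↦ exists_card_not_irreducible_add_le (g i) (hg i) (hirr i) (C x)
    (algebraMap k Ω t) (isSeparable_algebraMap t) (by
      rw [Polynomial.map_map]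
      refine hδ i _ ?_
      simpa [aeval_algebraMap_apply] using ht i)
  let s : k → k[X] := fun u ↦ (X - C t) * C u
  have hs : Function.Injective s := fun u v huv ↦
    C_injective (mul_left_cancel₀ (X_sub_C_ne_zero t) huv)
  obtain ⟨u, hu, hu'⟩ := exists_notMem_of_mk_lt hι
    (fun i ↦ {u : k | ¬ Irreducible ((g i).map (evalRingHom (s u + C x)))})
    (fun i ↦ by
      by_contra hinf
      obtain ⟨E, hE, hcard⟩ := Set.Infinite.exists_subset_card_eq hinf (N i + 1)
      have := hN i 1 1 le_rfl le_rfl (by simp [hmin]) (E.map ⟨s, hs⟩) (by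
        intro y hy
        obtain ⟨u, hu, rfl⟩ := Finset.mem_map.mp hy
        refine ⟨?_, ?_, hE hu⟩
        · rw [hmin, pow_one]
          exact dvd_mul_right _ _
        · exact (natDegree_mul_C_le _ _).trans (natDegree_X_sub_C_le t))
      rw [Finset.card_map] at this
      omega)
    ((fun u ↦ s u + C x) ⁻¹' B)
    ((mk_preimage_of_injective _ _ fun u v huv ↦ hs (add_right_cancel huv)).trans_lt hB)
  exact ⟨s u + C x, hu, fun i ↦ not_not.mp (hu' i)⟩

/-- Simultaneous specialization over `k[t]`, for perfect `k` and finite families. -/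
lemma exists_forall_irreducible_of_finite {ι : Type*} [Finite ι] [PerfectField k]
    (g : ι → k[X][X][X]) (hg : ∀ i, (g i).Monic) (hirr : ∀ i, Irreducible (g i))
    (hder : ∀ i, derivative (g i) ≠ 0) (B : Set k[X]) (hB : B.Finite) :
    ∃ a ∉ B, ∀ i, Irreducible ((g i).map (evalRingHom a)) := by
  classical
  have := Fintype.ofFinite ι
  choose δ hδ0 hδ using fun i ↦ exists_ne_zero_separable_map (hg i) (hirr i) (hder i)
  obtain ⟨x, hx⟩ := Infinite.exists_notMem_finset (∏ i, δ i).roots.toFinset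
  have hx : ∀ i, (δ i).eval x ≠ 0 := by
    simpa [Finset.prod_ne_zero_iff, hδ0, eval_prod, Finset.prod_eq_zero_iff] using hx
  let Ω := AlgebraicClosure k
  obtain ⟨t, ht⟩ := Infinite.exists_notMem_finset
    ((∏ i, (δ i).eval x).map (algebraMap k Ω)).roots.toFinset
  have ht : ∀ i, aeval t ((δ i).eval x) ≠ 0 := by
    rw [Multiset.mem_toFinset, mem_roots (by simpa [Finset.prod_eq_zero_iff] using hx), IsRoot,
      eval_map_algebraMap, map_prod, Finset.prod_eq_zero_iff] at ht
    simpa using ht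
  choose N hN using fun i ↦ exists_card_not_irreducible_add_le (g i) (hg i) (hirr i) x
    t (Algebra.IsSeparable.isSeparable k t) (by
      rw [Polynomial.map_map]
      refine hδ i _ ?_
      simpa using ht i)
  set P := minpoly k t
  have hP0 : P ≠ 0 := minpoly.ne_zero (Algebra.IsIntegral.isIntegral t)
  have hP : 0 < P.natDegree := minpoly.natDegree_pos (Algebra.IsIntegral.isIntegral t)
  set M := ∑ i, N i + hB.toFinset.card + 1 with hM
  let s : ℕ → k[X] := fun j ↦ P ^ (2 * M) * X ^ j
  have hs : Function.Injective s := fun u v huv ↦ by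
    simpa using congrArg natDegree (mul_left_cancel₀ (pow_ne_zero _ hP0) huv)
  by_contra! hcon
  have hsub : Finset.range M ⊆ {j ∈ Finset.range M | s j + x ∈ hB.toFinset} ∪
      Finset.univ.biUnion fun i ↦
        {j ∈ Finset.range M | ¬ Irreducible ((g i).map (evalRingHom (s j + x)))} := by
    intro j hj
    by_cases hjB : s j + x ∈ B
    · simp_all
    · obtain ⟨i, hi⟩ := hcon _ hjB
      simp only [Finset.mem_union, Finset.mem_biUnion, Finset.mem_filter]
      exact Or.inr ⟨i, Finset.mem_univ _, hj, hi⟩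
  have h1 : Finset.card {j ∈ Finset.range M | s j + x ∈ hB.toFinset} ≤ hB.toFinset.card :=
    Finset.card_le_card_of_injOn (fun j ↦ s j + x) (fun j hj ↦ (Finset.mem_filter.mp hj).2)
      fun a _ b _ hab ↦ hs (add_right_cancel hab)
  have h2 : ∀ i, Finset.card
      {j ∈ Finset.range M | ¬ Irreducible ((g i).map (evalRingHom (s j + x)))} ≤ N i := by
    intro i
    rw [← Finset.card_map ⟨s, hs⟩]
    refine hN i (2 * M) (2 * M * P.natDegree + M) (by omega) (by omega) ?_ _ fun y hy ↦ ?_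
    · nlinarith
    · obtain ⟨j, hj, rfl⟩ := Finset.mem_map.mp hy
      rw [Finset.mem_filter, Finset.mem_range] at hj
      refine ⟨dvd_mul_right _ _, ?_, hj.2⟩
      refine natDegree_mul_le_of_le (natDegree_pow_le) ?_
      rw [natDegree_X_pow]
      exact hj.1.le
  have h3 := (Finset.card_le_card hsub).trans ((Finset.card_union_le _ _).trans
    (add_le_add h1 (Finset.card_biUnion_le.trans (Finset.sum_le_sum fun i _ ↦ h2 i))))
  rw [Finset.card_range] at h3
  omega

open Cardinal in
/-- Simultaneous specialization over `k[t]`. -/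
lemma exists_forall_irreducible {k ι : Type} [Field k] (hι : #ι < #(RatFunc k))
    (g : ι → k[X][X][X]) (hg : ∀ i, (g i).Monic) (hirr : ∀ i, Irreducible (g i))
    (hder : ∀ i, derivative (g i) ≠ 0) (B : Set k[X]) (hB : #B < #(RatFunc k)) :
    ∃ a ∉ B, ∀ i, Irreducible ((g i).map (evalRingHom a)) := by
  rw [IsLocalization.cardinalMk (RatFunc k) (nonZeroDivisors k[X]) le_rfl,
    cardinalMk_eq_max] at hι hB
  rcases finite_or_infinite k with hk | hk
  · rw [max_eq_right (mk_le_aleph0 (α := k)), lt_aleph0_iff_finite] at hι hB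
    exact exists_forall_irreducible_of_finite g hg hirr hder B (Set.toFinite B)
  · rw [max_eq_left (aleph0_le_mk k)] at hι hB
    exact exists_forall_irreducible_of_infinite hι g hg hirr hder B hB

end Simultaneous

section Compositum

lemma derivative_minpoly_add_ne_zero {A K F : Type*} [CommRing A] [IsDomain A]
    [IsIntegrallyClosed A] [Field K] [Field F] [Algebra A K] [IsFractionRing A K] [Algebra A F]
    [Algebra K F] [IsScalarTower A K F] {p q : A[X]} (hp : p.Monic) (hq : q.Monic)
    (hps : (p.map (algebraMap A F)).Separable) (hqs : (q.map (algebraMap A F)).Separable)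
    {x y : F} (hx : aeval x p = 0) (hy : aeval y q = 0) :
    derivative (minpoly A (x + y)) ≠ 0 := by
  have hsep : ∀ {r : A[X]} {z : F}, (r.map (algebraMap A F)).Separable → aeval z r = 0 →
      IsSeparable K z := by
    intro r z hr hz
    have h1 : (r.map (algebraMap A K)).Separable := by
      refine (separable_map (algebraMap K F)).mp ?_
      rwa [Polynomial.map_map, ← IsScalarTower.algebraMap_eq]
    refine h1.of_dvd (minpoly.dvd _ _ ?_)
    rwa [aeval_map_algebraMap]
  have hint : IsIntegral A (x + y) := IsIntegral.add ⟨p, hp, hx⟩ ⟨q, hq, hy⟩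
  have h : (minpoly K (x + y)).Separable := Field.isSeparable_add (hsep hps hx) (hsep hqs hy)
  have hirr : Irreducible (minpoly K (x + y)) := minpoly.irreducible hint.tower_top
  rw [separable_iff_derivative_ne_zero hirr,
    minpoly.isIntegrallyClosed_eq_field_fractions' K hint, derivative_map] at h
  exact fun h0 ↦ h (by rw [h0, Polynomial.map_zero])

lemma exists_irreducible_eval₂_add_eq_zero {A F : Type*} [CommRing A] [IsDomain A]
    [IsIntegrallyClosed A] [Field F] (φ : A →+* F) (hφ : Function.Injective φ) {p q : A[X]}
    (hp : p.Monic) (hq : q.Monic) (hps : (p.map φ).Separable) (hqs : (q.map φ).Separable)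
    {x y : F} (hx : eval₂ φ x p = 0) (hy : eval₂ φ y q = 0) :
    ∃ g : A[X], g.Monic ∧ Irreducible g ∧ derivative g ≠ 0 ∧ eval₂ φ (x + y) g = 0 := by
  let := φ.toAlgebra
  have : FaithfulSMul A F := (faithfulSMul_iff_algebraMap_injective A F).mpr hφ
  let := FractionRing.liftAlgebra A F
  have hint : IsIntegral A (x + y) := IsIntegral.add ⟨p, hp, hx⟩ ⟨q, hq, hy⟩
  exact ⟨minpoly A (x + y), minpoly.monic hint, minpoly.irreducible hint,
    derivative_minpoly_add_ne_zero (K := FractionRing A) hp hq hps hqs hx hy, minpoly.aeval A _⟩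

lemma finite_setOf_taylor_eq {Ω : Type*} [Field Ω] {p : Polynomial (Polynomial Ω)} (hp : 0 < p.natDegree) :
    {δ : Ω | taylor (C δ) p = p}.Finite := by
  have h0 : p - C (p.eval 0) ≠ 0 := by
    intro h
    rw [sub_eq_zero.mp h, natDegree_C] at hp
    exact hp.false
  refine ((finite_setOfPred_isRoot h0).preimage C_injective.injOn).subset fun δ hδ ↦ ?_
  have := congrArg (eval 0) (show taylor (C δ) p = p from hδ)
  rw [taylor_eval, zero_add] at this
  simp [this]

lemma exists_forall_taylor_smul_ne {A Ω : Type*} [CommRing A] [IsDomain A] [Infinite A] [Field Ω]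
    [Algebra A Ω] [FaithfulSMul A Ω] {p : Polynomial (Polynomial Ω)} (hp : 0 < p.natDegree) (s : Finset Ω) :
    ∃ c : A, ∀ x ∈ s, ∀ y ∈ s, x ≠ y → taylor (C (-(c • x))) p ≠ taylor (C (-(c • y))) p := by
  classical
  have hfin : (⋃ q ∈ s.offDiag, {c : A | taylor (C (c • (q.1 - q.2))) p = p}).Finite := by
    refine Set.Finite.biUnion s.offDiag.finite_toSet fun q hq ↦ ?_
    refine (finite_setOf_taylor_eq hp).preimage (f := fun c : A ↦ c • (q.1 - q.2))
      (Function.Injective.injOn fun c c' hcc ↦ ?_)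
    have hne : q.1 - q.2 ≠ 0 := sub_ne_zero.mpr (Finset.mem_offDiag.mp hq).2.2
    simp only [Algebra.smul_def] at hcc
    exact FaithfulSMul.algebraMap_injective A Ω (mul_right_cancel₀ hne hcc)
  obtain ⟨c, hc⟩ := hfin.exists_notMem
  simp only [Set.mem_iUnion, not_exists] at hc
  refine ⟨c, fun x hx y hy hxy h ↦ hc (x, y) (Finset.mem_offDiag.mpr ⟨hx, hy, hxy⟩) ?_⟩
  have := congrArg (taylor (C (c • x))) h
  rw [taylor_taylor, taylor_taylor, ← C_add, ← C_add, add_neg_cancel, C_0, taylor_zero] at this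
  rw [Set.mem_ofPred_eq, smul_sub, sub_eq_add_neg]
  exact this.symm

lemma exists_irreducible_natDegree_mul_le {A K Ω : Type*} [CommRing A] [IsDomain A]
    [UniqueFactorizationMonoid A] [Infinite A] [Field K] [Field Ω] [IsAlgClosed Ω] [Algebra A K]
    [IsFractionRing A K] [Algebra K Ω] [Algebra A Ω] [IsScalarTower A K Ω] [Normal K Ω]
    {p : A[X][X]} (hp : p.Monic) (hirr : Irreducible (p.map (mapRingHom (algebraMap A Ω))))
    (hder : derivative p ≠ 0) {z : Ω} (hz : IsIntegral A z) (hsep : IsSeparable K z) :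
    ∃ (c : A) (g : A[X][X]), g.Monic ∧ Irreducible g ∧ derivative g ≠ 0 ∧
      p.natDegree * (minpoly K z).natDegree ≤ g.natDegree ∧
      p.map (mapRingHom (algebraMap A Ω)) ∣
        taylor (C (c • z)) (g.map (mapRingHom (algebraMap A Ω))) := by
  classical
  have : FaithfulSMul A Ω := by
    rw [faithfulSMul_iff_algebraMap_injective, IsScalarTower.algebraMap_eq A K Ω]
    exact (algebraMap K Ω).injective.comp (IsFractionRing.injective A K)
  have hj : Function.Injective (mapRingHom (algebraMap A Ω)) :=
    map_injective _ (FaithfulSMul.algebraMap_injective A Ω)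
  set j := mapRingHom (algebraMap A Ω) with hj'
  set P := p.map j with hP
  have hPm : P.Monic := hp.map j
  have hPd : 0 < P.natDegree := hPm.natDegree_pos_of_not_isUnit hirr.not_isUnit
  set s := ((minpoly K z).aroots Ω).toFinset with hs
  obtain ⟨c, hc⟩ := exists_forall_taylor_smul_ne (A := A) hPd s
  set Q : Ω → Polynomial (Polynomial Ω) := fun x ↦ taylor (C (-(c • x))) P with hQ
  have hQm : ∀ x, (Q x).Monic := fun x ↦ by
    rw [Monic, leadingCoeff_taylor]
    exact hPm
  have hQi : ∀ x, Irreducible (Q x) := fun x ↦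
    (MulEquiv.irreducible_iff (taylorEquiv (C (-(c • x))))).mpr hirr
  let F := AlgebraicClosure (FractionRing (Polynomial Ω))
  set ψ : Polynomial Ω →+* F := algebraMap (Polynomial Ω) F with hψ'
  have hψF : ψ = (algebraMap (FractionRing (Polynomial Ω)) F).comp (algebraMap _ _) :=
    IsScalarTower.algebraMap_eq _ _ _
  have hψ : Function.Injective ψ := by
    rw [hψF]
    exact (algebraMap (FractionRing (Polynomial Ω)) F).injective.comp (IsFractionRing.injective _ _)
  obtain ⟨η, hη⟩ : ∃ η, eval₂ ψ η P = 0 := by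
    refine IsAlgClosed.exists_eval₂_eq_zero_of_injective ψ hψ P ?_
    exact (natDegree_pos_iff_degree_pos.mp hPd).ne'
  have hcz : IsIntegral A (c • z) := hz.smul c
  have hczs : IsSeparable K (c • z) := by
    rw [Algebra.smul_def, IsScalarTower.algebraMap_apply A K Ω]
    exact Field.isSeparable_mul (isSeparable_algebraMap _) hsep
  have hPs : (p.map (ψ.comp j)).Separable := by
    rw [← Polynomial.map_map, hψF, ← Polynomial.map_map]
    refine Separable.map ?_
    rw [separable_iff_derivative_ne_zero
      ((hPm.irreducible_iff_irreducible_map_fraction_map (K := FractionRing (Polynomial Ω))).mp hirr),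
      derivative_map, Polynomial.map_ne_zero_iff (IsFractionRing.injective _ _), hP,
      derivative_map, Polynomial.map_ne_zero_iff hj]
    exact hder
  have hC : (ψ.comp j).comp C = ((ψ.comp C).comp (algebraMap K Ω)).comp (algebraMap A K) := by
    ext a
    simp [hj', IsScalarTower.algebraMap_apply A K Ω]
  have hqs : (((minpoly A (c • z)).map C).map (ψ.comp j)).Separable := by
    rw [Polynomial.map_map, hC, ← Polynomial.map_map,
      ← minpoly.isIntegrallyClosed_eq_field_fractions' K hcz]
    exact Separable.map hczs
  obtain ⟨g, hgm, hgi, hgd, hg⟩ := exists_irreducible_eval₂_add_eq_zero (ψ.comp j) (hψ.comp hj) hp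
    ((minpoly.monic hcz).map C) hPs hqs (x := η) (y := ψ (C (c • z))) (by rwa [← eval₂_map]) (by
      have := congrArg (fun x ↦ ψ (C x)) (minpoly.aeval A (c • z))
      simp only [map_zero, aeval_def, hom_eval₂] at this
      rw [eval₂_map]
      rwa [RingHom.comp_assoc, hj', mapRingHom_comp_C])
  have hdvd : ∀ x ∈ s, Q x ∣ g.map j := by
    have h1 : Q z ∣ g.map j := by
      have : FaithfulSMul (Polynomial Ω) F := (faithfulSMul_iff_algebraMap_injective _ _).mpr hψ
      have hθ : aeval (η + ψ (C (c • z))) (Q z) = 0 := by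
        rw [hQ, aeval_def, ← eval_map, map_taylor, taylor_eval, eval_map, C_neg, map_neg,
          add_neg_cancel_right, hη]
      have hθi : IsIntegral (Polynomial Ω) (η + ψ (C (c • z))) := ⟨Q z, hQm z, hθ⟩
      have h2 := minpoly.isIntegrallyClosed_dvd hθi hθ
      have h3 := (minpoly.irreducible hθi).associated_of_dvd (hQi z) h2
      refine h3.symm.dvd.trans (minpoly.isIntegrallyClosed_dvd hθi ?_)
      rwa [aeval_def, eval₂_map]
    intro x hx
    obtain ⟨σ, hσ⟩ := minpoly.exists_algEquiv_of_root' (K := K) (y := z) (x := x)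
      hsep.isIntegral.isAlgebraic (by
        rw [hs, Multiset.mem_toFinset, mem_aroots] at hx
        exact hx.2)
    have hσA : (σ : Ω →+* Ω).comp (algebraMap A Ω) = algebraMap A Ω := by
      ext a
      simp [IsScalarTower.algebraMap_apply A K Ω]
    have hσj : (mapRingHom (σ : Ω →+* Ω)).comp j = j := by
      rw [hj', mapRingHom_comp, hσA]
    have h2 := Polynomial.map_dvd (mapRingHom (σ : Ω →+* Ω)) h1
    rw [Polynomial.map_map, hσj, hQ, map_taylor, hP, Polynomial.map_map, hσj] at h2
    have hcx : σ (c • z) = c • x := by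
      rw [Algebra.smul_def, map_mul, hσ, Algebra.smul_def,
        IsScalarTower.algebraMap_apply A K Ω, σ.commutes]
    simpa [hcx, hQ] using h2
  refine ⟨c, g, hgm, hgi, hgd, ?_, ?_⟩
  · have h1 : ∏ x ∈ s, Q x ∣ g.map j := by
      refine Finset.prod_dvd_of_isRelPrime (fun x hx y hy hxy ↦ ?_) hdvd
      refine (hQi x).isRelPrime_iff_not_dvd.mpr fun h ↦ hc x hx y hy hxy ?_
      exact eq_of_monic_of_associated (hQm x) (hQm y) ((hQi x).associated_of_dvd (hQi y) h)
    have h2 := natDegree_le_of_dvd h1 (hgm.map j).ne_zero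
    rw [natDegree_prod_of_monic _ _ fun x _ ↦ hQm x, hgm.natDegree_map] at h2
    have h3 : s.card = (minpoly K z).natDegree := by
      have := Polynomial.card_rootSet_eq_natDegree (K := Ω) hsep (IsAlgClosed.splits _)
      rw [← this, hs, ← Fintype.card_coe]
      rfl
    simpa [hQ, natDegree_taylor, h3, hP, hp.natDegree_map, mul_comm] using h2
  · have hzs : z ∈ s := by
      rw [hs, Multiset.mem_toFinset, mem_aroots]
      exact ⟨minpoly.ne_zero hsep.isIntegral, minpoly.aeval K z⟩
    obtain ⟨h, hh⟩ := hdvd z hzs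
    rw [hh, taylor_mul, hQ, taylor_taylor, ← C_add, add_neg_cancel, C_0, taylor_zero]
    exact dvd_mul_right _ _

lemma _root_.Irreducible.scaleRoots {R : Type*} [CommRing R] [IsDomain R] {p : R[X]}
    (hp : Irreducible p) {r : R} (hr : IsUnit r) : Irreducible (p.scaleRoots r) := by
  obtain ⟨u, rfl⟩ := hr
  let e : R[X] ≃* R[X] :=
    { toFun := fun q ↦ q.scaleRoots u
      invFun := fun q ↦ q.scaleRoots ↑u⁻¹
      left_inv := fun q ↦ by simp [← scaleRoots_mul, scaleRoots_one]
      right_inv := fun q ↦ by simp [← scaleRoots_mul, scaleRoots_one]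
      map_mul' := fun q q' ↦ mul_scaleRoots_of_noZeroDivisors q q' u }
  exact (MulEquiv.irreducible_iff e).mpr hp

lemma irreducible_integralNormalization {R : Type*} [CommRing R] [IsDomain R]
    [UniqueFactorizationMonoid R] {p : R[X]} (hp : Irreducible p) (hd : p.natDegree ≠ 0) :
    Irreducible p.integralNormalization := by
  let L := FractionRing R
  have hinj := IsFractionRing.injective R L
  have hℓ : algebraMap R L p.leadingCoeff ≠ 0 := by
    rw [map_ne_zero_iff _ hinj]
    exact leadingCoeff_ne_zero.mpr hp.ne_zero
  rw [(monic_integralNormalization hp.ne_zero).irreducible_iff_irreducible_map_fraction_map (K := L),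
    ← integralNormalization_map _ _ hℓ]
  have h1 := (hp.isPrimitive hd).irreducible_iff_irreducible_map_fraction_map (K := L) |>.mp hp
  have hu : IsUnit (p.map (algebraMap R L)).leadingCoeff := by
    rw [leadingCoeff_map_of_leadingCoeff_ne_zero _ hℓ]
    exact hℓ.isUnit
  have h2 := h1.scaleRoots hu
  rw [← integralNormalization_mul_C_leadingCoeff] at h2
  exact (associated_mul_unit_right _ _ (isUnit_C.mpr hu)).irreducible_iff.mpr h2

lemma derivative_integralNormalization_ne_zero {R : Type*} [CommRing R] [IsDomain R] {p : R[X]}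
    (hp : derivative p ≠ 0) : derivative p.integralNormalization ≠ 0 := by
  have hp0 : p ≠ 0 := by
    rintro rfl
    simp at hp
  obtain ⟨i, hi⟩ : ∃ i, (derivative p).coeff i ≠ 0 := by
    by_contra! h
    exact hp (Polynomial.ext h)
  rw [coeff_derivative] at hi
  intro h
  have h1 := congrArg (coeff · i) h
  rw [coeff_derivative, integralNormalization_coeff] at h1
  split_ifs at h1
  · exact right_ne_zero_of_mul hi (by simpa using h1)
  · refine hi ?_
    have := pow_ne_zero (p.natDegree - 1 - (i + 1)) (leadingCoeff_ne_zero.mpr hp0)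
    rw [coeff_zero] at h1
    rcases mul_eq_zero.mp h1 with h2 | h2
    · rw [(mul_eq_zero.mp h2).resolve_right this, zero_mul]
    · rw [h2, mul_zero]

lemma exists_map_eq_C_C_mul {A K : Type*} [CommRing A] [IsDomain A] [Field K] [Algebra A K]
    [IsFractionRing A K] (f : K[X][X]) :
    ∃ (f₁ : A[X][X]) (b : A), b ≠ 0 ∧
      f₁.map (mapRingHom (algebraMap A K)) = C (C (algebraMap A K b)) * f := by
  let := Polynomial.algebra A K
  have := Polynomial.isLocalization (nonZeroDivisors A) K
  obtain ⟨_, ⟨b, hb, rfl⟩, h⟩ := IsLocalization.integerNormalization_spec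
    (Submonoid.map C (nonZeroDivisors A)) f
  refine ⟨_, b, nonZeroDivisors.ne_zero hb, h.trans (Polynomial.ext fun i ↦ ?_)⟩
  rw [coeff_smul, coeff_C_mul, Algebra.smul_def, Polynomial.algebraMap_def, coe_mapRingHom, map_C]

lemma natDegree_ne_zero_of_derivative_ne_zero {R : Type*} [Semiring R] {f : R[X]}
    (hf : derivative f ≠ 0) : f.natDegree ≠ 0 := fun h ↦
  hf (derivative_of_natDegree_zero h)

lemma exists_monic_model {A K Ω : Type*} [CommRing A] [IsDomain A] [Field K] [Field Ω]
    [Algebra A K] [IsFractionRing A K] [Algebra K Ω] [Algebra A Ω] [IsScalarTower A K Ω]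
    {f : K[X][X]} (hirr : Irreducible (f.map (mapRingHom (algebraMap K Ω))))
    (hder : derivative f ≠ 0) :
    ∃ (p : A[X][X]) (ℓ : A[X]), p.Monic ∧ Irreducible (p.map (mapRingHom (algebraMap A Ω))) ∧
      derivative p ≠ 0 ∧ p.natDegree = f.natDegree ∧ ℓ ≠ 0 ∧ ∀ a : A,
        (ℓ.eval a ≠ 0 →
          (f.map (evalRingHom (algebraMap A K a))).natDegree = f.natDegree) ∧
        ∀ y : Ω, aeval y (f.map (evalRingHom (algebraMap A K a))) = 0 →
          aeval (ℓ.eval a • y) (p.map (evalRingHom a)) = 0 := by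
  have hAK := IsFractionRing.injective A K
  have hm : Function.Injective (mapRingHom (algebraMap A K)) := map_injective _ hAK
  have hm' : Function.Injective (mapRingHom (algebraMap A Ω)) := by
    refine map_injective _ ?_
    rw [IsScalarTower.algebraMap_eq A K Ω]
    exact (algebraMap K Ω).injective.comp hAK
  obtain ⟨f₁, b, hb, hf⟩ := exists_map_eq_C_C_mul (A := A) f
  have hb' : algebraMap A K b ≠ 0 := (map_ne_zero_iff _ hAK).mpr hb
  have hu : IsUnit (C (algebraMap A K b)) := isUnit_C.mpr hb'.isUnit
  have hd : f₁.natDegree = f.natDegree := by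
    rw [← natDegree_map_eq_of_injective hm, hf, natDegree_C_mul hu.ne_zero]
  have hd0 : f.natDegree ≠ 0 := natDegree_ne_zero_of_derivative_ne_zero hder
  have hlc : mapRingHom (algebraMap A K) f₁.leadingCoeff = C (algebraMap A K b) * f.leadingCoeff := by
    rw [leadingCoeff, hd, ← coeff_map, hf, coeff_C_mul, leadingCoeff]
  have hf₁ : f₁ ≠ 0 := by
    rintro rfl
    exact hd0 (by rw [← hd, natDegree_zero])
  have hder₁ : derivative f₁ ≠ 0 := by
    rw [← Polynomial.map_ne_zero_iff hm, ← derivative_map, hf, derivative_C_mul]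
    exact mul_ne_zero (C_ne_zero.mpr hu.ne_zero) hder
  have hirr₁ : Irreducible (f₁.map (mapRingHom (algebraMap A Ω))) := by
    rw [IsScalarTower.algebraMap_eq A K Ω, ← mapRingHom_comp, ← Polynomial.map_map, hf,
      Polynomial.map_mul, map_C]
    exact (associated_unit_mul_right _ _
      (isUnit_C.mpr (hu.map (mapRingHom (algebraMap K Ω))))).irreducible_iff.mp hirr
  refine ⟨f₁.integralNormalization, f₁.leadingCoeff, monic_integralNormalization hf₁, ?_,
    derivative_integralNormalization_ne_zero hder₁, ?_, leadingCoeff_ne_zero.mpr hf₁, fun a ↦ ⟨?_, ?_⟩⟩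
  · rw [← integralNormalization_map]
    · refine irreducible_integralNormalization hirr₁ ?_
      rwa [natDegree_map_eq_of_injective hm', hd]
    · exact (map_ne_zero_iff _ hm').mpr (leadingCoeff_ne_zero.mpr hf₁)
  · rw [natDegree_integralNormalization, hd]
  · intro ha
    refine natDegree_map_of_leadingCoeff_ne_zero _ fun h ↦ ha ?_
    apply hAK
    rw [← eval_map_apply, map_zero]
    have := congrArg (eval (algebraMap A K a)) hlc
    rw [eval_mul] at this
    rw [coe_mapRingHom] at this
    rw [this, ← coe_evalRingHom, h, mul_zero]
  · intro y hy
    let φ : A[X] →+* Ω := (algebraMap A Ω).comp (evalRingHom a)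
    have hφ : φ = ((algebraMap K Ω).comp (evalRingHom (algebraMap A K a))).comp
        (mapRingHom (algebraMap A K)) := by
      refine Polynomial.ringHom_ext (fun x ↦ ?_) ?_ <;>
        simp [φ, IsScalarTower.algebraMap_apply A K Ω]
    have h0 : eval₂ φ y f₁ = 0 := by
      rw [hφ, ← eval₂_map, hf, eval₂_mul, ← eval₂_map, ← eval₂_map, ← aeval_def, ← aeval_def, hy,
        mul_zero]
    rw [aeval_def, eval₂_map, Algebra.smul_def]
    refine (integralNormalization_eval₂_leadingCoeff_mul ?_ φ y).trans (by rw [h0, mul_zero])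
    omega

open IntermediateField Module in
/-- Outside a finite set of `a`, the degree of `K(z, y)` over `K(z)`, for `y` a root of `f(a, Y)`,
is as large as possible as soon as a certain auxiliary polynomial remains irreducible at `a`. -/
lemma exists_finite_forall_mul_finrank_le {A K Ω : Type*} [CommRing A] [IsDomain A]
    [UniqueFactorizationMonoid A] [Infinite A] [Field K] [Field Ω] [IsAlgClosed Ω] [Algebra A K]
    [IsFractionRing A K] [Algebra K Ω] [Algebra A Ω] [IsScalarTower A K Ω] [Normal K Ω]
    {f : K[X][X]} (hirr : Irreducible (f.map (mapRingHom (algebraMap K Ω))))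
    (hder : derivative f ≠ 0) :
    ∃ B : Set A, B.Finite ∧
      (∀ a ∉ B, (f.map (evalRingHom (algebraMap A K a))).natDegree = f.natDegree ∧
        ∀ y : Ω, aeval y (f.map (evalRingHom (algebraMap A K a))) = 0 → IsSeparable K y) ∧
      ∀ z : Ω, IsSeparable K z → ∃ g : A[X][X], g.Monic ∧ Irreducible g ∧ derivative g ≠ 0 ∧
        ∀ a : A, Irreducible (g.map (evalRingHom a)) →
          ∀ y : Ω, aeval y (f.map (evalRingHom (algebraMap A K a))) = 0 →
            f.natDegree * finrank K K⟮z⟯ ≤ finrank K ↥(K⟮z⟯ ⊔ K⟮y⟯) := by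
  have hAK := IsFractionRing.injective A K
  obtain ⟨p, ℓ, hpm, hpi, hpd, hdeg, hℓ, hpa⟩ := exists_monic_model (A := A) hirr hder
  obtain ⟨δ, hδ, hsep⟩ := exists_ne_zero_separable_map hpm
    (hpm.irreducible_of_irreducible_map _ _ hpi) hpd
  refine ⟨{a | IsRoot (ℓ * δ) a}, finite_setOfPred_isRoot (mul_ne_zero hℓ hδ), ?_, ?_⟩
  · intro a ha
    have ha : ℓ.eval a ≠ 0 ∧ δ.eval a ≠ 0 := by simpa using ha
    refine ⟨(hpa a).1 ha.1, fun y hy ↦ ?_⟩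
    have h0 : algebraMap A K (ℓ.eval a) ≠ 0 := (map_ne_zero_iff _ hAK).mpr ha.1
    have h1 := hsep ((algebraMap A K).comp (evalRingHom a)) ((map_ne_zero_iff _ hAK).mpr ha.2)
    have h2 : IsSeparable K (ℓ.eval a • y) := by
      refine h1.of_dvd (minpoly.dvd _ _ ?_)
      rw [← Polynomial.map_map, aeval_map_algebraMap]
      exact (hpa a).2 y hy
    have h3 : y = algebraMap K Ω (algebraMap A K (ℓ.eval a))⁻¹ * (ℓ.eval a • y) := by
      rw [Algebra.smul_def, IsScalarTower.algebraMap_apply A K Ω, ← mul_assoc, ← map_mul,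
        inv_mul_cancel₀ h0, map_one, one_mul]
    rw [h3]
    exact Field.isSeparable_mul (isSeparable_algebraMap _) h2
  · intro z hz
    obtain ⟨r, hr, hrz⟩ := IsAlgebraic.exists_integral_multiple
      ((IsFractionRing.isAlgebraic_iff A K Ω).mpr hz.isIntegral.isAlgebraic)
    have hr' : algebraMap A K r ≠ 0 := (map_ne_zero_iff _ hAK).mpr hr
    have hz' : IsSeparable K (r • z) := by
      rw [Algebra.smul_def, IsScalarTower.algebraMap_apply A K Ω]
      exact Field.isSeparable_mul (isSeparable_algebraMap _) hz
    have hmemA : ∀ (L : IntermediateField K Ω) (a : A) {x : Ω}, x ∈ L → a • x ∈ L := by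
      intro L a x hx
      rw [Algebra.smul_def, IsScalarTower.algebraMap_apply A K Ω]
      exact L.mul_mem (L.algebraMap_mem _) hx
    have hadj : K⟮r • z⟯ = K⟮z⟯ := by
      apply le_antisymm <;> rw [adjoin_simple_le_iff]
      · exact hmemA _ _ (mem_adjoin_simple_self K z)
      · have h3 : z = algebraMap K Ω (algebraMap A K r)⁻¹ * (r • z) := by
          rw [Algebra.smul_def, IsScalarTower.algebraMap_apply A K Ω, ← mul_assoc, ← map_mul,
            inv_mul_cancel₀ hr', map_one, one_mul]
        exact Eq.mpr (congrArg (· ∈ K⟮r • z⟯) h3)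
          (mul_mem (IntermediateField.algebraMap_mem _ _) (mem_adjoin_simple_self K _))
    obtain ⟨c, g, hgm, hgi, hgd, hle, hdvd⟩ := exists_irreducible_natDegree_mul_le hpm hpi hpd hrz hz'
    refine ⟨g, hgm, hgi, hgd, fun a ha y hy ↦ ?_⟩
    set w := ℓ.eval a • y + c • (r • z) with hw
    have hwg : aeval w (g.map (evalRingHom a)) = 0 := by
      have h1 := Polynomial.map_dvd (evalRingHom (algebraMap A Ω a)) hdvd
      have hcomp : (evalRingHom (algebraMap A Ω a)).comp (mapRingHom (algebraMap A Ω)) =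
          (algebraMap A Ω).comp (evalRingHom a) := by
        refine Polynomial.ringHom_ext (fun x ↦ ?_) ?_ <;> simp
      rw [map_taylor, Polynomial.map_map, Polynomial.map_map, hcomp, ← Polynomial.map_map,
        ← Polynomial.map_map, coe_evalRingHom, eval_C] at h1
      have h2 := eval_eq_zero_of_dvd_of_eval_eq_zero h1 (x := ℓ.eval a • y)
        (by rw [eval_map_algebraMap]; exact (hpa a).2 y hy)
      rwa [taylor_eval, eval_map_algebraMap] at h2
    have hwi : minpoly K w = (g.map (evalRingHom a)).map (algebraMap A K) := by
      refine (minpoly.eq_of_irreducible_of_monic ?_ ?_ ?_).symm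
      · exact ((hgm.map _).irreducible_iff_irreducible_map_fraction_map (K := K)).mp ha
      · rwa [aeval_map_algebraMap]
      · exact (hgm.map _).map _
    have hint : ∀ x : Ω, IsIntegral K x := fun x ↦ Normal.isIntegral inferInstance x
    have hmem : w ∈ K⟮z⟯ ⊔ K⟮y⟯ :=
      add_mem (le_sup_right (a := K⟮z⟯) (hmemA _ _ (mem_adjoin_simple_self K y)))
        (le_sup_left (b := K⟮y⟯) (hmemA _ _ (hmemA _ _ (mem_adjoin_simple_self K z))))
    have hf1 : finrank K K⟮w⟯ = g.natDegree := by
      rw [adjoin.finrank (hint w), hwi, (hgm.map _).natDegree_map, hgm.natDegree_map]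
    rw [← hdeg, ← hadj, adjoin.finrank (hint _)]
    refine hle.trans (hf1.symm.le.trans ?_)
    rw [hadj]
    have := adjoin.finiteDimensional (hint z)
    have := adjoin.finiteDimensional (hint y)
    exact finrank_le_of_le_right (adjoin_simple_le_iff.mpr hmem)

end Compositum

section Independence

open IntermediateField Module

theorem linearDisjoint_iSup_adjoin_simple {K Ω ι : Type*} [Field K] [Field Ω] [Algebra K Ω]
    {b : ι → Ω} {d : ℕ} (hint : ∀ i, IsIntegral K (b i))
    (hd : ∀ F : Finset ι, finrank K (adjoin K (b '' (F : Set ι))) = d ^ F.card) (i : ι) :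
    K⟮b i⟯.LinearDisjoint ↥(⨆ (j : ι) (_ : j ≠ i), K⟮b j⟯) := by
  classical
  have hfin : ∀ F : Finset ι, FiniteDimensional K (adjoin K (b '' (F : Set ι))) := fun F ↦
    finiteDimensional_adjoin fun x hx ↦ by
      obtain ⟨j, -, rfl⟩ := hx
      exact hint j
  have hfg : ∀ F : Finset ι, i ∉ F → K⟮b i⟯.LinearDisjoint ↥(adjoin K (b '' (F : Set ι))) := by
    intro F hi
    have := adjoin.finiteDimensional (hint i)
    have := hfin F
    apply LinearDisjoint.of_finrank_sup
    have h1 := hd {i}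
    have h2 := hd (insert i F)
    rw [Finset.coe_singleton, Set.image_singleton, Finset.card_singleton, pow_one] at h1
    rw [Finset.coe_insert, Set.image_insert_eq, Finset.card_insert_of_notMem hi,
      Set.insert_eq, adjoin_union] at h2
    rw [h1, h2, hd F, pow_succ']
  rw [linearDisjoint_iff']
  refine Submodule.LinearDisjoint.of_linearDisjoint_fg_right _ _ fun N hN hNfg ↦ ?_
  obtain ⟨T, rfl⟩ := hNfg
  have hT : adjoin K (T : Set Ω) ≤ ⨆ j : {j // j ≠ i}, K⟮b j⟯ := by
    rw [adjoin_le_iff, iSup_subtype]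
    exact fun x hx ↦ hN (Submodule.subset_span hx)
  have hcpt : IsCompactElement (adjoin K (T : Set Ω)) := adjoin_finset_isCompactElement T
  obtain ⟨s, hs⟩ := CompleteLattice.IsCompactElement.exists_finset_of_le_iSup _ hcpt _ hT
  have h1 : i ∉ s.image Subtype.val := by simp
  have h2 := (linearDisjoint_iff' ..).mp (hfg _ h1)
  refine Submodule.LinearDisjoint.of_le_right_of_flat h2 (Submodule.span_le.mpr fun x hx ↦ ?_)
  refine (iSup₂_le fun j hj ↦ ?_ : ⨆ j ∈ s, K⟮b j⟯ ≤ _) (hs (subset_adjoin K _ hx))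
  exact adjoin_simple_le_iff.mpr (subset_adjoin K _ ⟨j, by simpa using ⟨j.2, hj⟩, rfl⟩)

theorem irreducible_of_natDegree_le_finrank {K Ω : Type*} [Field K] [Field Ω] [Algebra K Ω]
    {p : Polynomial K} {y : Ω} (hp : p ≠ 0) (hy : aeval y p = 0)
    (h : p.natDegree ≤ finrank K K⟮y⟯) : Irreducible p := by
  have hint : IsIntegral K y := IsAlgebraic.isIntegral ⟨p, hp, hy⟩
  rw [adjoin.finrank hint] at h
  exact (associated_of_dvd_of_natDegree_le (minpoly.dvd K y hy) hp h).irreducible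
    (minpoly.irreducible hint)

/-- There is a maximal set of indices outside `B` on whose finite subsets `b` generates extensions
of the largest degree `d ^ n`. -/
theorem exists_maximal_finrank_adjoin {K Ω ι : Type*} [Field K] [Field Ω] [Algebra K Ω]
    (b : ι → Ω) (d : ℕ) (B : Set ι) :
    ∃ S : Set ι, Maximal (fun S : Set ι ↦ Disjoint S B ∧ ∀ F : Finset ι, (F : Set ι) ⊆ S →
      finrank K (adjoin K (b '' (F : Set ι))) = d ^ F.card) S := by
  refine (zorn_subset_nonempty {S : Set ι | Disjoint S B ∧ ∀ F : Finset ι, (F : Set ι) ⊆ S →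
      finrank K (adjoin K (b '' (F : Set ι))) = d ^ F.card} ?_ ∅ ?_).imp fun S hS ↦ hS.2
  · refine fun c hc hchain hne ↦ ⟨⋃₀ c, ⟨?_, fun F hF ↦ ?_⟩, fun s hs ↦ Set.subset_sUnion_of_mem hs⟩
    · exact Set.disjoint_sUnion_left.mpr fun s hs ↦ (hc hs).1
    · rw [Set.sUnion_eq_biUnion] at hF
      obtain ⟨s, hs, hFs⟩ := DirectedOn.exists_mem_subset_of_finset_subset_biUnion hne
        hchain.directedOn hF
      exact (hc hs).2 F hFs
  · refine ⟨Set.empty_disjoint _, fun F hF ↦ ?_⟩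
    have : F = ∅ := by simpa [Set.subset_empty_iff] using hF
    subst this
    simp

end Independence

section FullyHilbertian

open IntermediateField Module

open Cardinal in
/-- A new specialization, independent of fewer than `#k(t)` given ones. -/
lemma exists_finrank_adjoin_insert {k Ω : Type} [Field k] [Field Ω] [IsAlgClosed Ω]
    [Algebra (RatFunc k) Ω] [Normal (RatFunc k) Ω] {f : (RatFunc k)[X][X]}
    (hirr : Irreducible (f.map (mapRingHom (algebraMap (RatFunc k) Ω)))) (hder : derivative f ≠ 0) :
    ∃ B : Set k[X], B.Finite ∧
      (∀ a ∉ B, (f.map (evalRingHom (algebraMap k[X] (RatFunc k) a))).natDegree = f.natDegree) ∧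
      ∀ b : k[X] → Ω,
      (∀ a ∉ B, aeval (b a) (f.map (evalRingHom (algebraMap k[X] (RatFunc k) a))) = 0) →
      ∀ S : Set k[X], Disjoint S B → #S < #(RatFunc k) → ∃ a ∉ S ∪ B,
        ∀ F : Finset k[X], (F : Set k[X]) ⊆ S → f.natDegree *
          finrank (RatFunc k) (adjoin (RatFunc k) (b '' (F : Set k[X]))) =
          finrank (RatFunc k) (adjoin (RatFunc k) (b '' (insert a F : Set k[X]))) := by
  have hpos := natDegree_ne_zero_of_derivative_ne_zero hder
  let _ : Algebra k[X] Ω := Algebra.compHom Ω (algebraMap k[X] (RatFunc k))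
  have : IsScalarTower k[X] (RatFunc k) Ω := IsScalarTower.of_algebraMap_eq' rfl
  obtain ⟨B, hB, hBf, hz⟩ := exists_finite_forall_mul_finrank_le (A := k[X]) hirr hder
  refine ⟨B, hB, fun a ha ↦ (hBf a ha).1, fun b hb S hSB hS ↦ ?_⟩
  have hinf : ℵ₀ ≤ #(RatFunc k) :=
    (aleph0_le_mk k[X]).trans (mk_le_of_injective (IsFractionRing.injective k[X] (RatFunc k)))
  have hsep : ∀ a ∉ B, IsSeparable (RatFunc k) (b a) := fun a ha ↦ (hBf a ha).2 _ (hb a ha)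
  have hprim : ∀ F : {F : Finset k[X] // (F : Set k[X]) ⊆ S}, ∃ z : Ω,
      IsSeparable (RatFunc k) z ∧
        adjoin (RatFunc k) (b '' (F : Set k[X])) = (RatFunc k)⟮z⟯ := by
    intro F
    have hF : ∀ x ∈ b '' (F : Set k[X]), IsSeparable (RatFunc k) x := by
      rintro _ ⟨a, ha, rfl⟩
      exact hsep a (Set.disjoint_left.mp hSB (F.2 ha))
    have := finiteDimensional_adjoin fun x hx ↦ (hF x hx).isIntegral
    have hFs := (isSeparable_adjoin_iff_isSeparable (F := RatFunc k) (E := Ω)).mpr hF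
    obtain ⟨z, hz⟩ := Field.exists_primitive_element (RatFunc k)
      (adjoin (RatFunc k) (b '' (F : Set k[X])))
    have h1 : (RatFunc k)⟮(z : Ω)⟯ = adjoin (RatFunc k) (b '' (F : Set k[X])) := by
      have := congrArg IntermediateField.lift hz
      rwa [lift_adjoin_simple, lift_top] at this
    rw [← h1] at hFs
    exact ⟨z, (isSeparable_adjoin_simple_iff_isSeparable _ _).mp hFs, h1.symm⟩
  choose z hzs hzF using hprim
  choose g hgm hgi hgd hg using fun F ↦ hz (z F) (hzs F)
  have hcard : #{F : Finset k[X] // (F : Set k[X]) ⊆ S} < #(RatFunc k) := by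
    have h1 : #{F : Finset k[X] // (F : Set k[X]) ⊆ S} ≤ #(Finset S) := by
      classical
      refine mk_le_of_injective (f := fun F ↦ F.1.subtype (· ∈ S)) fun F G h ↦ Subtype.ext ?_
      have := congrArg (Finset.map (Function.Embedding.subtype (· ∈ S))) h
      simpa [Finset.subtype_map, Finset.filter_true_of_mem fun x hx ↦ F.2 hx,
        Finset.filter_true_of_mem fun x hx ↦ G.2 hx] using this
    refine h1.trans_lt ?_
    rcases finite_or_infinite S with h | h
    · exact (lt_aleph0_of_finite _).trans_le hinf
    · rwa [mk_finset_of_infinite]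
  obtain ⟨a, ha, hga⟩ := exists_forall_irreducible hcard g hgm hgi hgd (S ∪ B)
    ((mk_union_le _ _).trans_lt (add_lt_of_lt hinf hS (hB.lt_aleph0.trans_le hinf)))
  refine ⟨a, ha, fun F hF ↦ ?_⟩
  have haB : a ∉ B := fun h ↦ ha (Or.inr h)
  have h1 := hg ⟨F, hF⟩ a (hga _) (b a) (hb a haB)
  rw [← hzF] at h1
  have h2 : adjoin (RatFunc k) (b '' (insert a F : Set k[X])) =
      adjoin (RatFunc k) (b '' (F : Set k[X])) ⊔ (RatFunc k)⟮b a⟯ := by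
    rw [Set.image_insert_eq, Set.insert_eq, adjoin_union, sup_comm]
  rw [h2]
  refine le_antisymm h1 ((finrank_sup_le _ _).trans ?_)
  rw [mul_comm]
  refine Nat.mul_le_mul_right _ ?_
  rw [adjoin.finrank (hsep a haB).isIntegral, ← (hBf a haB).1]
  exact natDegree_le_of_dvd (minpoly.dvd _ _ (hb a haB))
    fun h ↦ hpos (by rw [← (hBf a haB).1, h, natDegree_zero])

end FullyHilbertian

open IntermediateField Module Cardinal

/-- For any field `K₀`, the rational function field `K₀(t)` is fully
Hilbertian. -/
theorem ratFunc_isFullyHilbertian (K₀ : Type) [Field K₀] :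
    IsFullyHilbertian (RatFunc K₀) := by
  intro f hirr hder
  set K := RatFunc K₀
  have hpos := natDegree_ne_zero_of_derivative_ne_zero hder
  obtain ⟨B, -, hBf, hins⟩ := exists_finrank_adjoin_insert hirr hder
  have hne : ∀ a ∉ B, f.map (evalRingHom (algebraMap K₀[X] K a)) ≠ 0 := fun a ha h ↦
    hpos (by rw [← hBf a ha, h, natDegree_zero])
  have hroot : ∀ a : K₀[X], ∃ y : AlgebraicClosure K, a ∉ B →
      aeval y (f.map (evalRingHom (algebraMap K₀[X] K a))) = 0 := by
    intro a
    by_cases ha : a ∈ B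
    · exact ⟨0, fun h ↦ absurd ha h⟩
    · obtain ⟨y, hy⟩ := IsAlgClosed.exists_aeval_eq_zero (AlgebraicClosure K)
        (f.map (evalRingHom (algebraMap K₀[X] K a)))
        (fun h ↦ hpos (by rw [← hBf a ha, natDegree_eq_of_degree_eq_some (n := 0) h]))
      exact ⟨y, fun _ ↦ hy⟩
  choose b hb using hroot
  obtain ⟨S, ⟨hSB, hS⟩, hmax⟩ := exists_maximal_finrank_adjoin (K := K) b f.natDegree B
  have hinj : Function.Injective (algebraMap K₀[X] K) := IsFractionRing.injective _ _
  have hcard : #S = #K := by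
    refine ((mk_set_le S).trans (mk_le_of_injective hinj)).antisymm (not_lt.mp fun hlt ↦ ?_)
    classical
    obtain ⟨a, ha, haF⟩ := hins b hb S hSB hlt
    rw [Set.mem_union, not_or] at ha
    refine ha.1 (hmax ⟨Set.disjoint_insert_left.mpr ⟨ha.2, hSB⟩, fun F hF ↦ ?_⟩
      (Set.subset_insert a S) (Set.mem_insert a S))
    by_cases haF' : a ∈ F
    · have h1 : ((F.erase a : Finset K₀[X]) : Set K₀[X]) ⊆ S := by
        rw [Finset.coe_erase]
        exact Set.sdiff_singleton_subset_iff.mpr hF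
      have h2 := haF _ h1
      rwa [← Finset.coe_insert, Finset.insert_erase haF', hS _ h1, ← pow_succ',
        Finset.card_erase_add_one haF', eq_comm] at h2
    · exact hS F fun x hx ↦ (hF hx).resolve_left fun h ↦ haF' (h ▸ hx)
  have hSB' : ∀ a ∈ S, a ∉ B := fun a ha ↦ Set.disjoint_left.mp hSB ha
  choose r hrS hr using fun a : algebraMap K₀[X] K '' S ↦ a.2
  have hrinj : Function.Injective r := fun x y h ↦ Subtype.ext (by rw [← hr, h, hr])
  have hroot : ∀ a : algebraMap K₀[X] K '' S,
      aeval (b (r a)) (f.map (evalRingHom (a : K))) = 0 := fun a ↦ by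
    rw [← hr a]
    exact hb _ (hSB' _ (hrS a))
  refine ⟨algebraMap K₀[X] K '' S, fun a ↦ b (r a), ?_, (mk_image_eq hinj).trans hcard, hroot,
    linearDisjoint_iSup_adjoin_simple (d := f.natDegree)
      (fun _ ↦ Algebra.IsIntegral.isIntegral _) fun F ↦ ?_⟩
  · rintro _ ⟨a, ha, rfl⟩
    have h1 := hS {a} (by simpa using ha)
    rw [Finset.coe_singleton, Set.image_singleton, Finset.card_singleton, pow_one] at h1
    refine irreducible_of_natDegree_le_finrank (hne a (hSB' a ha)) (hb a (hSB' a ha)) ?_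
    rw [h1, hBf a (hSB' a ha)]
  · have h1 := hS (F.map ⟨r, hrinj⟩) (by
      rw [Finset.coe_map]
      exact Set.image_subset_iff.mpr fun x _ ↦ hrS x)
    rwa [Finset.card_map, Finset.coe_map, Set.image_image] at h1
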